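/- Let G_n(σ,τ) = n/2 − C([σ,τ])/2 + 1 where σ, τ are independent uniform random elements of S_n. Then E[G_n] − (n/2 − log(n)/2) converges to 1 − γ/2 as n → ∞, where γ is the Euler–Mascheroni constant; i.e. E[G_n] = n/2 − log(n)/2 − γ/2 + 1 + o(1). -/

import Mathlib

/-- Number of cycles of a permutation of `Fin n`, counting fixed points as 1-cycles. -/
def numCycles {n : ℕ} (π : Equiv.Perm (Fin n)) : ℕ :=
  Multiset.card π.cycleType + (Finset.univ.filter fun i => π i = i).card

/-- The expected value of `G_n = n/2 - C([σ,τ])/2 + 1` for `σ, τ` independent uniform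
on `S_n`. -/
noncomputable def expGenus (n : ℕ) : ℝ :=
  (∑ σ : Equiv.Perm (Fin n), ∑ τ : Equiv.Perm (Fin n),
    ((n : ℝ) / 2 - (numCycles (σ * τ * σ⁻¹ * τ⁻¹) : ℝ) / 2 + 1)) / (n.factorial : ℝ) ^ 2

section Part1

open Equiv Equiv.Perm

theorem card_image_le_aux {α β γ : Type*} [DecidableEq β] [DecidableEq γ] (s : Finset α) (f : α → β)
    (g : α → γ) (h : ∀ x ∈ s, ∀ y ∈ s, f x = f y → g x = g y) :
    (s.image g).card ≤ (s.image f).card := by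
  classical
  rcases s.eq_empty_or_nonempty with rfl | ⟨a, ha⟩
  · simp
  let k : β → γ := fun z => if hz : ∃ x ∈ s, f x = z then g hz.choose else g a
  have : s.image g = (s.image f).image k := by
    rw [Finset.image_image]
    refine Finset.image_congr fun x hx => ?_
    have hz : ∃ y ∈ s, f y = f x := ⟨x, hx, rfl⟩
    simp only [k, Function.comp, dif_pos hz]
    exact h x hx _ hz.choose_spec.1 hz.choose_spec.2.symm
  rw [this]
  exact Finset.card_image_le

noncomputable def cyc {α : Type*} (π : Perm α) : ℕ := Nat.card (Quotient (SameCycle.setoid π))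

theorem cyc_eq {α : Type*} [Fintype α] [DecidableEq α] (π : Perm α) :
    Multiset.card π.cycleType + (Finset.univ.filter fun i => π i = i).card = cyc π := by
  classical
  let q : α → Quotient (SameCycle.setoid π) := fun x => Quotient.mk _ x
  have hq : ∀ x y, q x = q y ↔ SameCycle π x y := fun x y => Quotient.eq
  have h1 : (Finset.univ : Finset (Quotient (SameCycle.setoid π))) =
      π.support.image q ∪ (Finset.univ.filter fun i => π i = i).image q := by
    ext z
    induction z using Quotient.inductionOn with
    | h x =>
      simp only [Finset.mem_univ, Finset.mem_union, Finset.mem_image, true_iff]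
      by_cases h : π x = x
      · right; exact ⟨x, by simpa using h, rfl⟩
      · left; exact ⟨x, by simpa using h, rfl⟩
  have h2 : Disjoint (π.support.image q) ((Finset.univ.filter fun i => π i = i).image q) := by
    rw [Finset.disjoint_left]
    intro z hz hz'
    simp only [Finset.mem_image, mem_support, Finset.mem_filter, Finset.mem_univ, true_and] at hz hz'
    obtain ⟨x, hx, rfl⟩ := hz
    obtain ⟨y, hy, hxy⟩ := hz'
    rw [hq] at hxy
    exact hx ((hxy.apply_eq_self_iff).1 hy)
  have h3 : ((Finset.univ.filter fun i => π i = i).image q).card =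
      (Finset.univ.filter fun i => π i = i).card := by
    apply Finset.card_image_of_injOn
    intro x hx y hy hxy
    rw [hq] at hxy
    simp at hx
    exact hxy.eq_of_left hx
  have h4 : (π.support.image q).card = Multiset.card π.cycleType := by
    have : π.cycleFactorsFinset = π.support.image (fun x => π.cycleOf x) := by
      ext c
      simp only [Finset.mem_image]
      constructor
      · intro hc
        obtain ⟨x, hx⟩ := (mem_cycleFactorsFinset_iff.1 hc).1.nonempty_support
        exact ⟨x, mem_cycleFactorsFinset_support_le hc hx,
          (cycle_is_cycleOf hx hc).symm⟩
      · rintro ⟨x, hx, rfl⟩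
        exact cycleOf_mem_cycleFactorsFinset_iff.2 hx
    rw [cycleType_def, Multiset.card_map, Finset.card_val, this]
    apply le_antisymm
    · apply card_image_le_aux
      intro x hx y hy h
      rw [hq]
      exact (sameCycle_iff_cycleOf_eq_of_mem_support hx hy).2 h
    · apply card_image_le_aux
      intro x hx y hy h
      rw [hq] at h
      exact h.cycleOf_eq
  rw [cyc, Nat.card_eq_fintype_card, ← Finset.card_univ, h1, Finset.card_union_of_disjoint h2, h3, h4]

theorem numCycles_eq {n : ℕ} (π : Perm (Fin n)) : numCycles π = cyc π := by
  rw [← cyc_eq]; rfl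

theorem sign_eq_cyc {α : Type*} [Fintype α] [DecidableEq α] (π : Perm α) :
    (sign π : ℤˣ) = (-1) ^ (Fintype.card α + cyc π) := by
  rw [sign_of_cycleType, sum_cycleType, ← cyc_eq]
  have h : Fintype.card α = π.support.card + (Finset.univ.filter fun i => π i = i).card := by
    rw [← Finset.card_univ, ← Finset.card_filter_add_card_filter_not (fun i => π i ≠ i)]
    congr 2
    ext; simp
  rw [h]
  generalize (Finset.univ.filter fun i => π i = i).card = a
  rw [show π.support.card + a + (Multiset.card π.cycleType + a) =
    (π.support.card + Multiset.card π.cycleType) + 2 * a by ring, pow_add _ _ (2*a), pow_mul]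
  simp

/-- invariant functions are functions on the orbits -/
def invEquiv {α : Type*} (β : Type*) (π : Perm α) :
    {f : α → β // ∀ x, f (π x) = f x} ≃ (Quotient (SameCycle.setoid π) → β) where
  toFun f := Quotient.lift f.1 (by
    rintro a b ⟨k, rfl⟩
    have h : ∀ x, f.1 (π x) = f.1 x := f.2
    have h' : ∀ x, f.1 (π⁻¹ x) = f.1 x := fun x => by
      conv_rhs => rw [← Equiv.apply_symm_apply π x]
      exact (h _).symm
    induction k with
    | zero => simp
    | succ k ih => rw [ih, add_comm, zpow_add, zpow_one, Perm.mul_apply, h]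
    | pred k ih => rw [ih, sub_eq_neg_add, zpow_add, zpow_neg_one, Perm.mul_apply, h'])
  invFun g := ⟨fun x => g (Quotient.mk _ x), fun x => congrArg g (Quotient.sound
    (show SameCycle π (π x) x from (sameCycle_apply_left).2 (SameCycle.refl _ _)))⟩
  left_inv f := by ext; rfl
  right_inv g := by
    funext z
    induction z using Quotient.inductionOn with
    | h x => rfl

theorem card_inv {α : Type*} [Fintype α] (π : Perm α) :
    Nat.card {f : α → Bool // ∀ x, f (π x) = f x} = 2 ^ cyc π := by
  classical
  rw [Nat.card_congr (invEquiv Bool π), cyc, Nat.card_fun]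
  simp
  
theorem cyc_conj {α : Type*} [Fintype α] (π τ : Perm α) : cyc (τ * π * τ⁻¹) = cyc π := by
  apply Nat.pow_right_injective (le_refl 2)
  simp only
  rw [← card_inv, ← card_inv]
  refine Nat.card_congr ⟨fun f => ⟨fun x => f.1 (τ x), fun x => ?_⟩,
    fun f => ⟨fun x => f.1 (τ⁻¹ x), fun x => ?_⟩, fun f => ?_, fun f => ?_⟩
  · have := f.2 (τ x); simpa using this
  · have := f.2 (τ⁻¹ x); simpa using this
  · ext; simp
  · ext; simp

theorem cyc_inv {α : Type*} [Fintype α] (π : Perm α) : cyc (π⁻¹) = cyc π := by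
  apply Nat.pow_right_injective (le_refl 2)
  simp only
  rw [← card_inv, ← card_inv]
  refine Nat.card_congr (Equiv.subtypeEquivRight fun f => ⟨fun h x => ?_, fun h x => ?_⟩)
  · have := h (π x); simpa using this.symm
  · have := h (π⁻¹ x); simpa using this.symm

theorem cyc_decomp {n : ℕ} (p : Fin (n+1)) (e : Perm (Fin n)) :
    cyc (decomposeFin.symm (p, e)) = cyc e + if p = 0 then 1 else 0 := by
  apply Nat.pow_right_injective (le_refl 2)
  simp only
  rw [pow_add, ← card_inv, ← card_inv]
  split_ifs with hp
  · subst hp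
    have : (2 ^ 1 : ℕ) = Nat.card Bool := by simp
    rw [this, ← Nat.card_prod]
    refine Nat.card_congr ⟨fun f => ⟨⟨fun x => f.1 x.succ, fun x => ?_⟩, f.1 0⟩,
      fun f => ⟨Fin.cons f.2 f.1.1, fun x => ?_⟩, fun f => ?_, fun f => ?_⟩
    · have := f.2 x.succ
      simpa [decomposeFin_symm_apply_succ] using this
    · refine Fin.cases ?_ (fun y => ?_) x
      · simp
      · have := f.1.2 y
        simpa [decomposeFin_symm_apply_succ] using this
    · ext x
      refine Fin.cases ?_ (fun y => ?_) x <;> simp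
    · ext <;> simp
  · obtain ⟨r, rfl⟩ := Fin.exists_succ_eq.2 hp
    simp only [pow_zero, mul_one]
    refine Nat.card_congr ⟨fun f => ⟨fun x => f.1 x.succ, fun x => ?_⟩,
      fun f => ⟨Fin.cons (f.1 r) f.1, fun x => ?_⟩, fun f => ?_, fun f => ?_⟩
    · have := f.2 x.succ
      have h0 := f.2 0
      rw [decomposeFin_symm_apply_zero] at h0
      rw [decomposeFin_symm_apply_succ] at this
      show f.1 (e x).succ = f.1 x.succ
      rw [← this]
      rcases eq_or_ne (e x) r with h | h
      · rw [h, swap_apply_right, h0]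
      · rw [swap_apply_of_ne_of_ne (Fin.succ_ne_zero _) (fun h' => h (Fin.succ_injective _ h'))]
    · refine Fin.cases ?_ (fun y => ?_) x
      · simp
      · rw [decomposeFin_symm_apply_succ]
        have := f.2 y
        rcases eq_or_ne (e y) r with h | h
        · rw [h, swap_apply_right]; simp [← this, h]
        · rw [swap_apply_of_ne_of_ne (Fin.succ_ne_zero _) (fun h' => h (Fin.succ_injective _ h'))]
          simp [this]
    · ext x
      refine Fin.cases ?_ (fun y => ?_) x
      · have h0 := f.2 0
        rw [decomposeFin_symm_apply_zero] at h0
        simp [h0]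
      · simp
    · ext; simp

theorem cyc_fin0 (e : Perm (Fin 0)) : cyc e = 0 := by
  rw [cyc, Nat.card_eq_zero]
  left
  exact ⟨fun z => by induction z using Quotient.inductionOn with | h x => exact x.elim0⟩

theorem sum_decomp {n : ℕ} {M : Type*} [AddCommMonoid M] (f : Perm (Fin (n+1)) → M) :
    ∑ π, f π = ∑ e : Perm (Fin n), (f (decomposeFin.symm (0, e)) +
      ∑ r : Fin n, f (decomposeFin.symm (r.succ, e))) := by
  rw [← Equiv.sum_comp decomposeFin.symm f, Fintype.sum_prod_type, Finset.sum_comm]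
  refine Finset.sum_congr rfl fun e _ => ?_
  rw [Fin.sum_univ_succ]

theorem sum_cyc (n : ℕ) : ∑ π : Perm (Fin n), (cyc π : ℝ) = n.factorial * (harmonic n : ℝ) := by
  induction n with
  | zero => simp [cyc_fin0]
  | succ n ih =>
    rw [sum_decomp]
    simp only [cyc_decomp, Fin.succ_ne_zero, if_false, if_true]
    simp only [Nat.cast_add, Nat.cast_one, Nat.cast_zero, add_zero, Finset.sum_const,
      Finset.card_univ, Fintype.card_fin, nsmul_eq_mul, Finset.sum_add_distrib, ← Finset.mul_sum, ih]
    rw [harmonic_succ, Nat.factorial_succ, Fintype.card_perm, Fintype.card_fin]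
    push_cast
    field_simp
    ring

theorem sum_two_pow_cyc (n : ℕ) : ∑ π : Perm (Fin n), (2 ^ cyc π : ℝ) = (n+1).factorial := by
  induction n with
  | zero => simp [cyc_fin0]
  | succ n ih =>
    rw [sum_decomp]
    simp only [cyc_decomp, Fin.succ_ne_zero, if_false, if_true, pow_add, add_zero, Finset.sum_const,
      Finset.card_univ, Fintype.card_fin, nsmul_eq_mul, Finset.sum_add_distrib, ← Finset.mul_sum,
      ← Finset.sum_mul, ih]
    rw [Nat.factorial_succ (n+1)]
    push_cast
    ring

theorem sum_cyc_sq_le (n : ℕ) : ∑ π : Perm (Fin n), (cyc π : ℝ)^2 ≤ 2 * (n+1).factorial := by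
  rw [← sum_two_pow_cyc, Finset.mul_sum]
  refine Finset.sum_le_sum fun π _ => ?_
  have : ∀ k : ℕ, k^2 ≤ 2 * 2^k := by
    intro k
    induction k with
    | zero => simp
    | succ k ih =>
      rcases Nat.lt_or_ge k 3 with h | h
      · interval_cases k <;> norm_num
      · rw [pow_succ 2 k]; nlinarith
  exact_mod_cast this (cyc π)

theorem sum_sign_cyc (n : ℕ) : |∑ π : Perm (Fin (n+2)), (sign π : ℝ) * (cyc π : ℝ)| = n.factorial := by
  have key : ∀ n : ℕ, ∑ π : Perm (Fin (n+1)), (sign π : ℝ) * (cyc π : ℝ) =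
      ∑ e : Perm (Fin n), (sign e : ℝ) + (1 - n) * ∑ π : Perm (Fin n), (sign π : ℝ) * (cyc π : ℝ) := by
    intro n
    rw [sum_decomp]
    simp only [cyc_decomp, Fin.succ_ne_zero, if_false, if_true, decomposeFin.symm_sign, one_mul]
    simp only [Nat.cast_add, Nat.cast_one, Nat.cast_zero, add_zero, Finset.sum_const,
      Finset.card_univ, Fintype.card_fin, nsmul_eq_mul, Finset.mul_sum]
    rw [← Finset.sum_add_distrib]
    refine Finset.sum_congr rfl fun e _ => ?_
    push_cast
    ring
  induction n with
  | zero =>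
    rw [key, key]
    have h0 : ∀ (e : Perm (Fin 0)), e = 1 := fun e => Subsingleton.elim _ _
    have h1 : ∀ (e : Perm (Fin 1)), e = 1 := fun e => Subsingleton.elim _ _
    simp [h1, cyc_fin0]
  | succ n ih =>
    rw [key, abs_eq_abs.2 (Or.inl rfl)]
    have : ∑ e : Perm (Fin (n+2)), (sign e : ℝ) = 0 := by
      have h := Equiv.sum_comp (Equiv.mulLeft (swap (0 : Fin (n+2)) 1)) (fun e => (sign e : ℝ))
      simp [Perm.sign_mul, sign_swap (show (0 : Fin (n+2)) ≠ 1 by simp)] at h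
      linarith
    rw [this, zero_add, abs_mul, ih, Nat.factorial_succ]
    push_cast
    congr 1
    rw [abs_of_nonpos] <;> [ring; linarith]

end Part1

section Part2

open Equiv Equiv.Perm
set_option linter.unusedSectionVars false
set_option linter.unusedSimpArgs false

section Wed

variable {G : Type*} [Group G] [Fintype G] [DecidableEq G] {r : ℕ} {d : Fin r → ℕ}
  (φ : MonoidAlgebra ℂ G ≃ₐ[ℂ] (Π i, Matrix (Fin (d i)) (Fin (d i)) ℂ))

theorem coeff_mul_s (a : MonoidAlgebra ℂ G) (g h : G) :
    (a * MonoidAlgebra.single g 1).coeff h = a.coeff (h * g⁻¹) := by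
  rw [MonoidAlgebra.coeff_mul_single_eq_coeff_mul (h * g⁻¹), mul_one]
  intro m _
  exact eq_mul_inv_iff_mul_eq.symm

theorem coeff_s_mul (a : MonoidAlgebra ℂ G) (g h : G) :
    (MonoidAlgebra.single g 1 * a).coeff h = a.coeff (g⁻¹ * h) := by
  rw [MonoidAlgebra.coeff_single_mul_eq_mul_coeff (g⁻¹ * h), one_mul]
  intro m _
  exact eq_inv_mul_iff_mul_eq.symm

theorem central_scalar (hd : ∀ i, NeZero (d i)) (z : MonoidAlgebra ℂ G)
    (hz : ∀ g : G, MonoidAlgebra.single g 1 * z = z * MonoidAlgebra.single g 1) :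
    ∃ ω : Fin r → ℂ, ∀ i, φ z i = ω i • 1 := by
  have hz' : ∀ a, a * z = z * a := by
    intro a
    induction a using MonoidAlgebra.induction_linear with
    | zero => simp
    | add x y hx hy => rw [add_mul, mul_add, hx, hy]
    | single g c =>
      have : MonoidAlgebra.single g c = c • MonoidAlgebra.single g (1 : ℂ) := by
        rw [MonoidAlgebra.smul_single]; simp
      rw [this, smul_mul_assoc, mul_smul_comm, hz]
  have : ∀ i, ∃ w : ℂ, φ z i = w • 1 := by
    intro i
    have : φ z i ∈ Set.range (Matrix.scalar (Fin (d i))) := by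
      apply Matrix.mem_range_scalar_of_commute_single
      intro a b _
      have h := hz' (φ.symm (Pi.single i (Matrix.single a b 1)))
      have h2 := congrFun (congrArg φ h) i
      rw [map_mul, map_mul] at h2
      have h3 : Matrix.single a b 1 * φ z i = φ z i * Matrix.single a b 1 := by simpa using h2
      exact h3
    obtain ⟨w, hw⟩ := this
    refine ⟨w, ?_⟩
    rw [← hw]
    ext a b
    simp [Matrix.scalar_apply, Matrix.diagonal_apply, Matrix.one_apply]
  choose ω h using this
  exact ⟨ω, h⟩

theorem trace_A (f : MonoidAlgebra ℂ G →ₗ[ℂ] MonoidAlgebra ℂ G) :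
    LinearMap.trace ℂ _ f = ∑ g : G, (f (MonoidAlgebra.single g 1)).coeff g := by
  rw [LinearMap.trace_eq_matrix_trace ℂ (MonoidAlgebra.basis G ℂ), Matrix.trace]
  refine Finset.sum_congr rfl fun g _ => ?_
  rw [Matrix.diag_apply, LinearMap.toMatrix_apply]
  rfl

theorem trace_Pi (f : (Π i, Matrix (Fin (d i)) (Fin (d i)) ℂ) →ₗ[ℂ] (Π i, Matrix (Fin (d i)) (Fin (d i)) ℂ)) :
    LinearMap.trace ℂ _ f = ∑ i, ∑ a, ∑ b, f (Pi.single i (Matrix.single a b 1)) i a b := by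
  rw [LinearMap.trace_eq_matrix_trace ℂ (Pi.basis fun i => Matrix.stdBasis ℂ (Fin (d i)) (Fin (d i))),
    Matrix.trace, Fintype.sum_sigma]
  refine Finset.sum_congr rfl fun i _ => ?_
  rw [Fintype.sum_prod_type]
  refine Finset.sum_congr rfl fun a _ => Finset.sum_congr rfl fun b _ => ?_
  rw [Matrix.diag_apply, LinearMap.toMatrix_apply, Pi.basis_apply, Matrix.stdBasis_eq_single,
    Pi.basis_repr]
  rfl

theorem dims_sum (z : MonoidAlgebra ℂ G) (w : Fin r → ℂ) (hw : ∀ i, φ z i = w i • 1) :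
    ∑ i, (d i : ℂ)^2 * w i = Fintype.card G * z.coeff 1 := by
  have h1 := trace_A (LinearMap.mulLeft ℂ z)
  rw [← LinearMap.trace_conj' _ φ.toLinearEquiv, trace_Pi] at h1
  have h2 : ∑ g : G, ((LinearMap.mulLeft ℂ z) (MonoidAlgebra.single g 1)).coeff g =
      Fintype.card G * z.coeff 1 := by
    simp [coeff_mul_s]
  rw [← h2, ← h1]
  refine Finset.sum_congr rfl fun i _ => ?_
  have : ∀ a b, (φ.toLinearEquiv.conj (LinearMap.mulLeft ℂ z)) (Pi.single i (Matrix.single a b 1)) i a b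
      = w i := by
    intro a b
    rw [LinearEquiv.conj_apply_apply]
    simp [hw]
  simp only [this]
  simp
  ring

theorem omega_sum (hd : ∀ i, NeZero (d i)) (z : MonoidAlgebra ℂ G) (w : Fin r → ℂ)
    (hw : ∀ i, φ z i = w i • 1) :
    Fintype.card G * ∑ i, w i = ∑ σ : G, ∑ τ : G, z.coeff (σ * τ * σ⁻¹ * τ⁻¹) := by
  let s : G → MonoidAlgebra ℂ G := fun g => MonoidAlgebra.single g 1
  have hs : ∀ g h, s g * s h = s (g * h) := fun g h => by simp [s, MonoidAlgebra.single_mul_single]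
  have hs1 : s 1 = 1 := rfl
  let Q : MonoidAlgebra ℂ G →ₗ[ℂ] MonoidAlgebra ℂ G :=
    ∑ τ : G, LinearMap.mulLeft ℂ (s τ) ∘ₗ LinearMap.mulRight ℂ (s τ⁻¹)
  have hQ : ∀ a, Q a = ∑ τ : G, s τ * (a * s τ⁻¹) := fun a => by simp [Q]
  have hQc : ∀ a g, s g * Q a = Q a * s g := by
    intro a g
    rw [hQ, Finset.mul_sum, Finset.sum_mul, ← Equiv.sum_comp (Equiv.mulLeft g⁻¹)]
    refine Finset.sum_congr rfl fun τ _ => ?_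
    simp only [Equiv.coe_mulLeft, mul_inv_rev, inv_inv]
    rw [← mul_assoc, hs, mul_inv_cancel_left, ← hs]
    simp only [mul_assoc]
  have hQt : ∀ a i, (φ (Q a) i).trace = Fintype.card G * (φ a i).trace := by
    intro a i
    rw [hQ, map_sum, Finset.sum_apply, Matrix.trace_sum]
    have : ∀ τ, (φ (s τ * (a * s τ⁻¹)) i).trace = (φ a i).trace := by
      intro τ
      rw [map_mul, Pi.mul_apply, Matrix.trace_mul_comm, map_mul, Pi.mul_apply, mul_assoc,
        ← Pi.mul_apply, ← map_mul, hs, inv_mul_cancel, hs1, map_one, Pi.one_apply, mul_one]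
    simp only [this]
    simp
  have hQs : ∀ a i, φ (Q a) i = ((Fintype.card G * (φ a i).trace) / d i : ℂ) • 1 := by
    intro a i
    obtain ⟨u, hu⟩ := central_scalar φ hd (Q a) (hQc a)
    have h := hQt a i
    rw [hu i] at h ⊢
    rw [← h]
    have : (d i : ℂ) ≠ 0 := by exact_mod_cast (hd i).out
    simp [this]
  have h1 := trace_A (LinearMap.mulLeft ℂ z ∘ₗ Q)
  rw [← LinearMap.trace_conj' _ φ.toLinearEquiv, trace_Pi] at h1
  have h2 : ∑ g : G, ((LinearMap.mulLeft ℂ z ∘ₗ Q) (MonoidAlgebra.single g 1)).coeff g =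
      ∑ σ : G, ∑ τ : G, z.coeff (σ * τ * σ⁻¹ * τ⁻¹) := by
    refine Finset.sum_congr rfl fun σ _ => ?_
    rw [LinearMap.comp_apply, hQ, LinearMap.mulLeft_apply, Finset.mul_sum, MonoidAlgebra.coeff_sum,
      Finsupp.finsetSum_apply]
    refine Finset.sum_congr rfl fun τ _ => ?_
    change (z * (s τ * (s σ * s τ⁻¹))).coeff σ = _
    rw [hs, hs]
    simp only [s]
    rw [coeff_mul_s]
    congr 1
    group
  rw [← h2, ← h1, Finset.mul_sum]
  refine Finset.sum_congr rfl fun i _ => ?_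
  have : ∀ a b, (φ.toLinearEquiv.conj (LinearMap.mulLeft ℂ z ∘ₗ Q)) (Pi.single i (Matrix.single a b 1)) i a b
      = if a = b then w i * (Fintype.card G / d i) else 0 := by
    intro a b
    rw [LinearEquiv.conj_apply_apply]
    simp only [LinearMap.comp_apply, LinearMap.mulLeft_apply, AlgEquiv.toLinearEquiv_apply,
      map_mul, Pi.mul_apply, hw, hQs]
    have : φ (φ.toLinearEquiv.symm (Pi.single i (Matrix.single a b 1))) i = Matrix.single a b 1 := by
      have := φ.toLinearEquiv.apply_symm_apply (Pi.single i (Matrix.single a b 1))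
      rw [AlgEquiv.toLinearEquiv_apply] at this
      rw [this]; simp
    rw [this]
    rcases eq_or_ne a b with h | h
    · subst h; simp [Matrix.trace_single_eq_same]; try ring
    · simp [h, Matrix.trace_single_eq_of_ne]
  simp only [this]
  have : (d i : ℂ) ≠ 0 := by exact_mod_cast (hd i).out
  simp
  field_simp

end Wed

end Part2

section Part3

open Equiv Equiv.Perm
set_option linter.unusedSectionVars false
set_option linter.unusedSimpArgs false

section Wed2

variable {G : Type*} [Group G] [Fintype G] [DecidableEq G] {r : ℕ} {d : Fin r → ℕ}
  (φ : MonoidAlgebra ℂ G ≃ₐ[ℂ] (Π i, Matrix (Fin (d i)) (Fin (d i)) ℂ))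

noncomputable def mkA (c : G → ℂ) : MonoidAlgebra ℂ G := ∑ g, MonoidAlgebra.single g (c g)

theorem mkA_coeff (c : G → ℂ) (h : G) : (mkA c).coeff h = c h := by
  rw [mkA, MonoidAlgebra.coeff_sum, Finsupp.finsetSum_apply]
  simp [Finsupp.single_apply]

theorem mkA_eq (c : G → ℂ) : mkA c = ∑ g, c g • MonoidAlgebra.single g (1 : ℂ) := by
  rw [mkA]
  refine Finset.sum_congr rfl fun g _ => ?_
  rw [MonoidAlgebra.smul_single]; simp

theorem mkA_mul_coeff (c : G → ℂ) (u : MonoidAlgebra ℂ G) (h : G) :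
    (mkA c * u).coeff h = ∑ g, c g * u.coeff (g⁻¹ * h) := by
  rw [mkA_eq, Finset.sum_mul, MonoidAlgebra.coeff_sum, Finsupp.finsetSum_apply]
  refine Finset.sum_congr rfl fun g _ => ?_
  rw [smul_mul_assoc, MonoidAlgebra.coeff_smul, Finsupp.smul_apply, coeff_s_mul, smul_eq_mul]

noncomputable def uu (i : Fin r) : MonoidAlgebra ℂ G := φ.symm (Pi.single i 1)

theorem phi_uu_mul (i : Fin r) (a : MonoidAlgebra ℂ G) : φ (uu φ i * a) = Pi.single i (φ a i) := by
  rw [map_mul, uu, AlgEquiv.apply_symm_apply]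
  ext j : 1
  rcases eq_or_ne i j with h | h
  · subst h; simp
  · simp [Pi.single_eq_of_ne h.symm]

theorem phi_mul_uu (i : Fin r) (a : MonoidAlgebra ℂ G) : φ (a * uu φ i) = Pi.single i (φ a i) := by
  rw [map_mul, uu, AlgEquiv.apply_symm_apply]
  ext j : 1
  rcases eq_or_ne i j with h | h
  · subst h; simp
  · simp [Pi.single_eq_of_ne h.symm]

theorem uu_comm (i : Fin r) (a : MonoidAlgebra ℂ G) : uu φ i * a = a * uu φ i := by
  apply φ.injective
  rw [phi_uu_mul, phi_mul_uu]

theorem omega_real (hd : ∀ i, NeZero (d i)) (c : G → ℝ) (hc : ∀ g, c g⁻¹ = c g) (w : Fin r → ℂ)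
    (hw : ∀ i, φ (mkA fun g => (c g : ℂ)) i = w i • 1) (i : Fin r) :
    (starRingEnd ℂ) (w i) = w i := by
  set u := uu φ i with hu
  have h1 : mkA (fun g => (c g : ℂ)) * u = w i • u := by
    apply φ.injective
    rw [phi_mul_uu, hw, map_smul, hu, uu, AlgEquiv.apply_symm_apply, Pi.single_smul]
  have h2 : ∀ h, ∑ g, (c g : ℂ) * u.coeff (g⁻¹ * h) = w i * u.coeff h := by
    intro h
    rw [← mkA_mul_coeff, h1]; simp
  have hu0 : u ≠ 0 := by
    intro h0
    have h3 := congrFun (congrArg φ h0) i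
    rw [hu, uu, AlgEquiv.apply_symm_apply, map_zero, Pi.single_eq_same] at h3
    have := hd i
    exact one_ne_zero h3
  obtain ⟨h0, hh0⟩ : ∃ h, u.coeff h ≠ 0 := by
    by_contra hcon
    push Not at hcon
    apply hu0
    ext h
    simp [hcon h]
  have hN : (∑ h, u.coeff h * (starRingEnd ℂ) (u.coeff h)) ≠ 0 := by
    simp only [Complex.mul_conj]
    rw [← Complex.ofReal_sum]
    have : 0 < ∑ h, Complex.normSq (u.coeff h) :=
      Finset.sum_pos' (fun _ _ => Complex.normSq_nonneg _) ⟨h0, Finset.mem_univ _, Complex.normSq_pos.2 hh0⟩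
    exact_mod_cast this.ne'
  have h4 : w i * (∑ h, u.coeff h * (starRingEnd ℂ) (u.coeff h)) =
      ∑ h, ∑ g, (c g : ℂ) * u.coeff (g⁻¹ * h) * (starRingEnd ℂ) (u.coeff h) := by
    rw [Finset.mul_sum]
    refine Finset.sum_congr rfl fun h _ => ?_
    rw [← mul_assoc, ← h2, Finset.sum_mul]
  have h5 : (starRingEnd ℂ) (∑ h, ∑ g, (c g : ℂ) * u.coeff (g⁻¹ * h) * (starRingEnd ℂ) (u.coeff h)) =
      ∑ h, ∑ g, (c g : ℂ) * u.coeff (g⁻¹ * h) * (starRingEnd ℂ) (u.coeff h) := by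
    simp only [map_sum, map_mul, Complex.conj_conj, Complex.conj_ofReal]
    rw [Finset.sum_comm]
    conv_rhs => rw [Finset.sum_comm, ← Equiv.sum_comp (Equiv.inv G)]
    refine Finset.sum_congr rfl fun g _ => ?_
    rw [← Equiv.sum_comp (Equiv.mulLeft g)]
    refine Finset.sum_congr rfl fun h _ => ?_
    simp [hc]
    ring
  rw [← h4] at h5
  have h6 : (starRingEnd ℂ) (∑ h, u.coeff h * (starRingEnd ℂ) (u.coeff h)) =
    ∑ h, u.coeff h * (starRingEnd ℂ) (u.coeff h) := by
    simp only [map_sum, map_mul, Complex.conj_conj]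
    exact Finset.sum_congr rfl fun _ _ => mul_comm _ _
  rw [map_mul, h6] at h5
  exact mul_right_cancel₀ hN h5

theorem omega_bound (hd : ∀ i, NeZero (d i)) (c : G → ℝ) (hc : ∀ g, c g⁻¹ = c g) (w : Fin r → ℂ)
    (hw : ∀ i, φ (mkA fun g => (c g : ℂ)) i = w i • 1) (i : Fin r) :
    (d i : ℝ)^2 * ‖w i‖^2 ≤ Fintype.card G * ∑ g, c g ^ 2 := by
  have h1 := dims_sum φ (mkA (fun g => (c g : ℂ)) * mkA (fun g => (c g : ℂ))) (fun i => w i * w i)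
    (by intro i; rw [map_mul, Pi.mul_apply, hw]; simp [smul_smul])
  have h2 : ∀ i, w i * w i = ((‖w i‖^2 : ℝ) : ℂ) := by
    intro i
    have := omega_real φ hd c hc w hw i
    rw [← Complex.normSq_eq_norm_sq, ← Complex.mul_conj, this]
  simp only [h2, mkA_mul_coeff, mkA_coeff, mul_one, hc] at h1
  have h3 : ∑ i, (d i : ℝ)^2 * ‖w i‖^2 = Fintype.card G * ∑ g, c g * c g := by
    exact_mod_cast h1
  calc _ ≤ ∑ i, (d i : ℝ)^2 * ‖w i‖^2 :=
        Finset.single_le_sum (f := fun i => (d i : ℝ)^2 * ‖w i‖^2) (fun i _ => by positivity) (Finset.mem_univ i)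
    _ = _ := by rw [h3]; simp only [sq]

theorem count_gen {T : Type*} [Fintype T] (e : MonoidAlgebra ℂ G) (κ : ℂ) (hκ : κ ≠ 0)
    (he : e * e = κ • e) (t : G → T)
    (ht : ∀ g g', t g = t g' → ∃ ε : ℂ, e * MonoidAlgebra.single g' 1 * e =
      ε • (e * MonoidAlgebra.single g 1 * e)) :
    Nat.card {i // φ e i ≠ 0} ≤ Fintype.card T := by
  classical
  let b : T → MonoidAlgebra ℂ G := fun x => if h : ∃ g, t g = x then
    e * MonoidAlgebra.single h.choose 1 * e else 0
  have hb : ∀ g, e * MonoidAlgebra.single g 1 * e ∈ Submodule.span ℂ (Set.range b) := by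
    intro g
    have hx : ∃ g', t g' = t g := ⟨g, rfl⟩
    obtain ⟨ε, h⟩ := ht _ _ hx.choose_spec
    rw [h]
    refine Submodule.smul_mem _ _ (Submodule.subset_span ⟨t g, ?_⟩)
    simp only [b]
    rw [dif_pos hx]
  have hb2 : ∀ a, e * a * e ∈ Submodule.span ℂ (Set.range b) := by
    intro a
    induction a using MonoidAlgebra.induction_linear with
    | zero => simp
    | add x y hx hy => rw [mul_add, add_mul]; exact Submodule.add_mem _ hx hy
    | single g c =>
      have : MonoidAlgebra.single g c = c • MonoidAlgebra.single g (1 : ℂ) := by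
        rw [MonoidAlgebra.smul_single]; simp
      rw [this, mul_smul_comm, smul_mul_assoc]
      exact Submodule.smul_mem _ _ (hb g)
  let v : {i // φ e i ≠ 0} → MonoidAlgebra ℂ G := fun i => uu φ i * e
  have hv : LinearIndependent ℂ v := by
    rw [Fintype.linearIndependent_iff]
    intro c hc i
    have h := congrFun (congrArg φ hc) i
    rw [map_sum, map_zero, Finset.sum_apply, Finset.sum_eq_single i] at h
    · simp only [v] at h
      rw [map_smul, phi_uu_mul, Pi.smul_apply, Pi.single_eq_same] at h
      exact (smul_eq_zero.1 h).resolve_right i.2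
    · intro j _ hj
      simp only [v]
      rw [map_smul, phi_uu_mul, Pi.smul_apply, Pi.single_eq_of_ne, smul_zero]
      intro h'
      exact hj (Subtype.ext h'.symm)
    · simp
  have hvs : Set.range v ≤ Submodule.span ℂ (Set.range b) := by
    rintro _ ⟨i, rfl⟩
    have : v i = κ⁻¹ • (e * uu φ i * e) := by
      rw [← uu_comm, mul_assoc, he, mul_smul_comm, smul_smul, inv_mul_cancel₀ hκ, one_smul]
    rw [this]
    exact Submodule.smul_mem _ _ (hb2 _)
  have := linearIndependent_le_span' v hv (Set.range b) hvs
  rw [Nat.card_eq_fintype_card]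
  have h2 : Fintype.card {i // φ e i ≠ 0} ≤ Fintype.card (Set.range b) := by
    rw [Cardinal.mk_fintype] at this
    exact_mod_cast this
  exact h2.trans (Fintype.card_range_le b)

/-- twisted symmetrizer -/
noncomputable def ee (K : Subgroup G) [DecidablePred (· ∈ K)] (θ : K →* ℤˣ) : MonoidAlgebra ℂ G :=
  ∑ h : K, ((θ h : ℤ) : ℂ) • MonoidAlgebra.single (h : G) (1 : ℂ)

variable (K : Subgroup G) [DecidablePred (· ∈ K)] (θ : K →* ℤˣ)

theorem units_sq (x : ℤˣ) : ((x : ℤ) : ℂ) * ((x : ℤ) : ℂ) = 1 := by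
  rcases Int.units_eq_one_or x with h | h <;> simp [h]

theorem s_mul_ee (h : K) : MonoidAlgebra.single (h : G) (1 : ℂ) * ee K θ = ((θ h : ℤ) : ℂ) • ee K θ := by
  rw [ee, Finset.mul_sum, Finset.smul_sum, ← Equiv.sum_comp (Equiv.mulLeft h) (fun k : K => ((θ h : ℤ) : ℂ) • ((θ k : ℤ) : ℂ) • MonoidAlgebra.single (k : G) (1 : ℂ))]
  refine Finset.sum_congr rfl fun k _ => ?_
  simp only [Equiv.coe_mulLeft, map_mul, Units.val_mul, Int.cast_mul, smul_smul, ← mul_assoc, units_sq, one_mul, mul_smul_comm]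
  simp [MonoidAlgebra.single_mul_single]

theorem ee_mul_s (h : K) : ee K θ * MonoidAlgebra.single (h : G) (1 : ℂ) = ((θ h : ℤ) : ℂ) • ee K θ := by
  rw [ee, Finset.sum_mul, Finset.smul_sum, ← Equiv.sum_comp (Equiv.mulRight h) (fun k : K => ((θ h : ℤ) : ℂ) • ((θ k : ℤ) : ℂ) • MonoidAlgebra.single (k : G) (1 : ℂ))]
  refine Finset.sum_congr rfl fun k _ => ?_
  simp only [Equiv.coe_mulRight, map_mul, Units.val_mul, Int.cast_mul, smul_smul, smul_mul_assoc]
  rw [mul_left_comm, units_sq, mul_one]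
  simp [MonoidAlgebra.single_mul_single]

theorem ee_mul_ee : ee K θ * ee K θ = (Fintype.card K : ℂ) • ee K θ := by
  have : ∀ x, ee K θ * x = ∑ h : K, ((θ h : ℤ) : ℂ) • (MonoidAlgebra.single (h : G) (1 : ℂ) * x) := by
    intro x
    rw [ee, Finset.sum_mul]
    simp only [smul_mul_assoc]
  rw [this]
  simp only [s_mul_ee, smul_smul, units_sq, one_smul]
  rw [Finset.sum_const, Finset.card_univ, Nat.cast_smul_eq_nsmul]

theorem count_ee {T : Type*} [Fintype T] (t : G → T)
    (ht : ∀ g g', t g = t g' → ∃ h h' : K, g' = h * g * h') :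
    Nat.card {i // φ (ee K θ) i ≠ 0} ≤ Fintype.card T := by
  refine count_gen φ (ee K θ) (Fintype.card K) (by exact_mod_cast Fintype.card_ne_zero) (ee_mul_ee K θ) t ?_
  intro g g' hg
  obtain ⟨h, h', e⟩ := ht g g' hg
  refine ⟨((θ h : ℤ) : ℂ) * ((θ h' : ℤ) : ℂ), ?_⟩
  have : MonoidAlgebra.single g' (1 : ℂ) = MonoidAlgebra.single (h : G) 1 * MonoidAlgebra.single g 1
     * MonoidAlgebra.single (h' : G) 1 := by
    simp [MonoidAlgebra.single_mul_single, e]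
  rw [this, ← mul_assoc, ← mul_assoc, ee_mul_s, mul_assoc, s_mul_ee]
  simp only [smul_mul_assoc, mul_smul_comm, smul_smul, mul_comm]

end Wed2

end Part3

section Part4

open Equiv Equiv.Perm
set_option linter.unusedSectionVars false
set_option linter.unusedSimpArgs false

section Abs

variable {Q : Type*} [Fintype Q] [DecidableEq Q]

def sg (f : Q → Fin 3) : ℝ := ∏ x, if f x = 0 then -1 else 1

theorem sg_tog (f : Q → Fin 3) (o : Q) (ho : f o ≠ 1) :
    sg (Function.update f o (2 - f o)) = - sg f := by
  unfold sg
  rw [← Finset.mul_prod_erase _ _ (Finset.mem_univ o), ← Finset.mul_prod_erase _ (fun x => if f x = 0 then (-1:ℝ) else 1) (Finset.mem_univ o), ← neg_mul]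
  congr 1
  · rw [Function.update_self]
    generalize f o = y at ho ⊢
    fin_cases y <;> simp at ho ⊢
  · refine Finset.prod_congr rfl fun x hx => ?_
    rw [Function.update_of_ne (Finset.ne_of_mem_erase hx)]

theorem tog_ne_one (f : Q → Fin 3) (o x : Q) :
    Function.update f o (2 - f o) x = 1 ↔ f x = 1 := by
  rcases eq_or_ne x o with h | h
  · subst h
    rw [Function.update_self]
    generalize f x = y
    revert y; decide
  · rw [Function.update_of_ne h]

noncomputable def pick (S : Finset Q) (o : Q) : Q := by
  classical
  exact if h : S.Nonempty then h.choose else o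

theorem pick_mem (S : Finset Q) (o : Q) (h : S.Nonempty) : pick S o ∈ S := by
  unfold pick; rw [dif_pos h]; exact h.choose_spec

theorem abs_inner (l : Q → ℝ) (o : Q) :
    ∑ f : Q → Fin 3, (if f o = 2 then sg f / (∑ x, if f x = 1 then 0 else l x) else 0) = 1 / l o := by
  classical
  let f0 : Q → Fin 3 := Function.update (fun _ => 1) o 2
  rw [← Finset.add_sum_erase _ _ (Finset.mem_univ f0)]
  have h1 : (if f0 o = 2 then sg f0 / (∑ x, if f0 x = 1 then 0 else l x) else 0) = 1 / l o := by
    have e1 : sg f0 = 1 := by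
      unfold sg
      refine Finset.prod_eq_one fun x _ => ?_
      rcases eq_or_ne x o with h | h
      · subst h; simp [f0]
      · simp [f0, h]
    have e2 : (∑ x, if f0 x = 1 then 0 else l x) = l o := by
      rw [Finset.sum_eq_single o]
      · simp [f0]
      · intro x _ hx; simp [f0, hx]
      · simp
    rw [e1, e2]; simp [f0]
  rw [h1, add_eq_left]
  let S : (Q → Fin 3) → Finset Q := fun f => Finset.univ.filter fun x => x ≠ o ∧ f x ≠ 1
  let T : (Q → Fin 3) → (Q → Fin 3) := fun f => if f o = 2 then
    Function.update f (pick (S f) o) (2 - f (pick (S f) o)) else f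
  have hST : ∀ f, S (T f) = S f := by
    intro f
    simp only [T]
    split_ifs
    · simp only [S, ne_eq, tog_ne_one]
    · rfl
  have hS : ∀ f, f ≠ f0 → f o = 2 → pick (S f) o ≠ o ∧ f (pick (S f) o) ≠ 1 := by
    intro f hf hfo
    have hn : (S f).Nonempty := by
      by_contra hcon
      apply hf
      ext1 x
      rcases eq_or_ne x o with h | h
      · subst h; simp [f0, hfo]
      · simp only [f0, Function.update_of_ne h]
        by_contra hx
        exact hcon ⟨x, by simp [S, h, hx]⟩
    have := pick_mem (S f) o hn
    simpa [S] using this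
  have hTo : ∀ f, f ≠ f0 → (T f o = 2 ↔ f o = 2) := by
    intro f hf
    simp only [T]
    split_ifs with h
    · rw [Function.update_of_ne (hS f hf h).1.symm]
    · rfl
  have hTT : ∀ f, f ≠ f0 → T (T f) = f := by
    intro f hf
    by_cases h : f o = 2
    · have h2 := (hTo f hf).2 h
      have : T (T f) = Function.update (T f) (pick (S f) o) (2 - T f (pick (S f) o)) := by
        conv_lhs => unfold T
        rw [if_pos h2, hST]
      rw [this]
      simp only [T, if_pos h]
      ext1 x
      rcases eq_or_ne x (pick (S f) o) with h | h
      · rw [h]; simp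
      · simp [h]
    · simp only [T, if_neg h]
  refine Finset.sum_involution (fun f _ => T f) ?_ ?_ ?_ ?_
  · intro f hf
    have hf := Finset.ne_of_mem_erase hf
    by_cases h : f o = 2
    · rw [if_pos h, if_pos ((hTo f hf).2 h)]
      simp only [T, if_pos h]
      rw [sg_tog _ _ (hS f hf h).2]
      simp only [tog_ne_one]
      ring
    · rw [if_neg h, if_neg (mt (hTo f hf).1 h), add_zero]
  · intro f hf hne
    have hf := Finset.ne_of_mem_erase hf
    have h : f o = 2 := by by_contra h; simp [h] at hne
    intro he
    have h3 := congrArg sg he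
    simp only [T, if_pos h] at h3
    rw [sg_tog _ _ (hS f hf h).2] at h3
    have : sg f = 0 := by linarith
    simp [this] at hne
  · intro f hf
    have hf := Finset.ne_of_mem_erase hf
    refine Finset.mem_erase.2 ⟨?_, Finset.mem_univ _⟩
    intro he
    have : S f = ∅ := by
      rw [← hST, he]
      ext x
      simp [S, f0]
      intro hx; simp [hx]
    by_cases h : f o = 2
    · have h5 := (hS f hf h).1
      rw [this] at h5
      simp [pick] at h5
    · have := (hTo f hf).not.2 h
      rw [he] at this
      simp [f0] at this
  · intro f hf
    exact hTT f (Finset.ne_of_mem_erase hf)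

theorem abs_sum (l : Q → ℝ) (hl : ∀ x, l x ≠ 0) :
    ∑ f : Q → Fin 3, sg f * (∑ x, if f x = 2 then l x else 0) / (∑ x, if f x = 1 then 0 else l x)
      = Fintype.card Q := by
  have : ∀ f : Q → Fin 3, sg f * (∑ x, if f x = 2 then l x else 0) / (∑ x, if f x = 1 then 0 else l x)
     = ∑ o, l o * (if f o = 2 then sg f / (∑ x, if f x = 1 then 0 else l x) else 0) := by
    intro f
    rw [Finset.mul_sum, Finset.sum_div]
    refine Finset.sum_congr rfl fun o _ => ?_
    split_ifs
    · ring
    · simp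
  simp only [this]
  rw [Finset.sum_comm]
  simp only [← Finset.mul_sum, abs_inner]
  simp [hl]

end Abs

end Part4

section Part5

open Equiv Equiv.Perm
set_option linter.unusedSectionVars false
set_option linter.unusedSimpArgs false

section Col

variable {α β : Type*} [Fintype α] [DecidableEq α] [DecidableEq β]

def stab (c : α → β) : Subgroup (Perm α) where
  carrier := {h | ∀ x, c (h x) = c x}
  mul_mem' := by
    intro a b ha hb x
    rw [Perm.mul_apply, ha, hb]
  one_mem' := fun x => rfl
  inv_mem' := by
    intro a ha x
    have := ha (a⁻¹ x)
    simp at this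
    exact this.symm

theorem mem_stab (c : α → β) (h : Perm α) : h ∈ stab c ↔ ∀ x, c (h x) = c x := Iff.rfl

instance (c : α → β) : DecidablePred (· ∈ stab c) := fun h =>
  inferInstanceAs (Decidable (∀ x, c (h x) = c x))

theorem exists_perm_fiber {γ : Type*} [DecidableEq γ] (u u' : α → γ)
    (h : ∀ a, (Finset.univ.filter fun x => u x = a).card = (Finset.univ.filter fun x => u' x = a).card) :
    ∃ k : Perm α, ∀ x, u (k x) = u' x := by
  have h2 : ∀ a, Nonempty ({x // u' x = a} ≃ {x // u x = a}) := by
    intro a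
    rw [← Fintype.card_eq, Fintype.card_subtype, Fintype.card_subtype, h]
  let e : ∀ a, ({x // u' x = a} ≃ {x // u x = a}) := fun a => (h2 a).some
  refine ⟨(Equiv.sigmaFiberEquiv u').symm.trans ((Equiv.sigmaCongrRight e).trans (Equiv.sigmaFiberEquiv u)), ?_⟩
  intro x
  simp [Equiv.sigmaFiberEquiv]
  exact (e (u' x) ⟨x, rfl⟩).2

theorem dcoset (c : α → β) (g g' : Perm α)
    (h : ∀ a b, (Finset.univ.filter fun x => c x = a ∧ c (g x) = b).card =
      (Finset.univ.filter fun x => c x = a ∧ c (g' x) = b).card) :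
    ∃ h h' : stab c, g' = h * g * h' := by
  obtain ⟨k, hk⟩ := exists_perm_fiber (fun x => (c x, c (g x))) (fun x => (c x, c (g' x))) (by
    rintro ⟨a, b⟩
    simpa using h a b)
  simp only [Prod.mk.injEq] at hk
  refine ⟨⟨g' * k⁻¹ * g⁻¹, ?_⟩, ⟨k, fun x => (hk x).1⟩, by simp⟩
  intro y
  have := (hk (k⁻¹ (g⁻¹ y))).2
  simp at this
  simp [this]

def thI (c : α → Fin 3) : stab c →* ℤˣ where
  toFun h := sign (subtypePerm h.1 (p := fun x => c x = 0) (fun x => by rw [h.2 x]))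
  map_one' := by
    rw [← sign_one (α := {x // c x = 0})]; rfl
  map_mul' a b := by
    rw [← Perm.sign_mul]; rfl

noncomputable def ec (c : α → Fin 3) : MonoidAlgebra ℂ (Perm α) := ee (stab c) (thI c)

theorem ec_conj (c : α → Fin 3) (k : Perm α) :
    ec (fun x => c (k x)) = MonoidAlgebra.single k⁻¹ 1 * ec c * MonoidAlgebra.single k 1 := by
  rw [ec, ec, ee, ee, Finset.mul_sum, Finset.sum_mul]
  let E : stab (fun x => c (k x)) ≃ stab c :=
    { toFun := fun h => ⟨k * h * k⁻¹, fun x => by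
        have := h.2 (k⁻¹ x); simpa using this⟩
      invFun := fun h => ⟨k⁻¹ * h * k, fun x => by
        have := h.2 (k x); simpa using this⟩
      left_inv := fun h => by ext; simp
      right_inv := fun h => by ext; simp }
  rw [← Equiv.sum_comp E]
  refine Finset.sum_congr rfl fun h _ => ?_
  have h1 : thI c (E h) = thI _ h := by
    symm
    refine sign_eq_sign_of_equiv _ _ (Equiv.subtypeEquiv k (by simp)) ?_
    intro x
    ext
    simp [E]
  rw [h1, mul_smul_comm, smul_mul_assoc, MonoidAlgebra.single_mul_single, MonoidAlgebra.single_mul_single]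
  simp [E, mul_assoc]

noncomputable def wt (c : α → Fin 3) : ℝ :=
  sg c * (∑ x, if c x = 2 then 1 else 0) / (∑ x, if c x = 1 then 0 else 1)

theorem cyc_sub (π : Perm α) (f : Quotient (SameCycle.setoid π) → Fin 3)
    (h : ∀ x, (fun x => f (Quotient.mk _ x) = 0) (π x) ↔ (fun x => f (Quotient.mk _ x) = 0) x) :
    cyc (subtypePerm π (p := fun x => f (Quotient.mk _ x) = 0) h) = Nat.card {o // f o = 0} := by
  rw [cyc]
  refine Nat.card_congr (Equiv.ofBijective (fun q => Quotient.lift (fun x => (⟨Quotient.mk _ x.1, x.2⟩ : {o // f o = 0})) ?_ q) ⟨?_, ?_⟩)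
  · intro a b hab
    ext
    exact Quotient.sound (sameCycle_subtypePerm.1 hab)
  · intro q q'
    induction q using Quotient.inductionOn with | h x =>
    induction q' using Quotient.inductionOn with | h y =>
    intro hxy
    simp at hxy
    exact Quotient.sound (sameCycle_subtypePerm.2 (Quotient.exact hxy))
  · rintro ⟨o, ho⟩
    induction o using Quotient.inductionOn with | h x =>
    exact ⟨Quotient.mk _ ⟨x, ho⟩, rfl⟩

theorem sg_eq {Q : Type*} [Fintype Q] (f : Q → Fin 3) : sg f = (-1) ^ Nat.card {o // f o = 0} := by
  classical
  rw [sg, Finset.prod_ite]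
  simp [Fintype.card_subtype]

theorem ee_coeff {G : Type*} [Group G] [Fintype G] [DecidableEq G] (K : Subgroup G) [DecidablePred (· ∈ K)] (θ : K →* ℤˣ)
    (g : G) : (ee K θ).coeff g = if h : g ∈ K then ((θ ⟨g, h⟩ : ℤ) : ℂ) else 0 := by
  rw [ee, MonoidAlgebra.coeff_sum, Finsupp.finsetSum_apply]
  simp only [MonoidAlgebra.coeff_smul, Finsupp.smul_apply, MonoidAlgebra.coeff_single, Finsupp.single_apply]
  split_ifs with h
  · rw [Finset.sum_eq_single ⟨g, h⟩]
    · simp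
    · intro b _ hb
      rw [if_neg]
      · simp
      · intro h'; exact hb (Subtype.ext h')
    · simp
  · refine Finset.sum_eq_zero fun x _ => ?_
    rw [if_neg]
    · simp
    · rintro rfl; exact h x.2

theorem z_eq : mkA (fun π : Perm α => ((cyc π : ℝ) : ℂ)) = ∑ c : α → Fin 3, (wt c : ℂ) • ec c := by
  classical
  ext π
  rw [mkA_coeff, MonoidAlgebra.coeff_sum, Finsupp.finsetSum_apply]
  simp only [MonoidAlgebra.coeff_smul, Finsupp.smul_apply, ec, ee_coeff, smul_eq_mul]
  have h1 : ∀ c : α → Fin 3, (wt c : ℂ) * (if h : π ∈ stab c then (((thI c) ⟨π, h⟩ : ℤ) : ℂ) else 0)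
     = if h : ∀ x, c (π x) = c x then ((wt c * ((thI c ⟨π, (mem_stab c π).2 h⟩ : ℤ) : ℝ) : ℝ) : ℂ) else 0 := by
    intro c
    by_cases h : ∀ x, c (π x) = c x
    · rw [dif_pos h, dif_pos ((mem_stab c π).2 h)]; push_cast; rfl
    · rw [dif_neg h, dif_neg (mt (mem_stab c π).1 h), mul_zero]
  simp only [h1]
  rw [← Finset.sum_filter_add_sum_filter_not Finset.univ (fun c : α → Fin 3 => ∀ x, c (π x) = c x)]
  rw [Finset.sum_eq_zero (s := Finset.univ.filter fun c : α → Fin 3 => ¬ ∀ x, c (π x) = c x), add_zero]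
  swap
  · intro c hc
    rw [dif_neg (Finset.mem_filter.1 hc).2]
  rw [Finset.sum_subtype (p := fun c : α → Fin 3 => ∀ x, c (π x) = c x) _ (by simp)]
  rw [← Equiv.sum_comp (invEquiv (Fin 3) π).symm]
  let l : Quotient (SameCycle.setoid π) → ℝ := fun o => (Finset.univ.filter fun x => Quotient.mk _ x = o).card
  have hl : ∀ o, l o ≠ 0 := by
    intro o
    induction o using Quotient.inductionOn with | h x =>
    simp only [l]
    exact_mod_cast (Finset.card_pos.2 ⟨x, by simp⟩).ne'
  have hsum : ∀ F : Quotient (SameCycle.setoid π) → ℝ, ∑ x, F (Quotient.mk _ x) = ∑ o, F o * l o := by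
    intro F
    rw [← Finset.sum_fiberwise _ (fun x => (Quotient.mk (SameCycle.setoid π) x))]
    refine Finset.sum_congr rfl fun o _ => ?_
    rw [Finset.sum_congr rfl (g := fun _ => F o)]
    · simp [l, mul_comm]
    · intro x hx
      rw [(Finset.mem_filter.1 hx).2]
  have h2 := abs_sum l hl
  have h3 : ((cyc π : ℝ)) = Fintype.card (Quotient (SameCycle.setoid π)) := by
    rw [cyc, Nat.card_eq_fintype_card]
  rw [h3, ← h2, Complex.ofReal_sum]
  refine Finset.sum_congr rfl fun f _ => ?_
  have h4 := ((invEquiv (Fin 3) π).symm f).2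
  rw [dif_pos h4]
  congr 1
  have h5 : ((invEquiv (Fin 3) π).symm f).1 = fun x => f (Quotient.mk _ x) := rfl
  have key : sg (fun x => f (Quotient.mk (SameCycle.setoid π) x)) * ((thI ((invEquiv (Fin 3) π).symm f).1 ⟨π, (mem_stab _ π).2 h4⟩ : ℤ) : ℝ) = sg f := by
    have h7 : thI ((invEquiv (Fin 3) π).symm f).1 ⟨π, (mem_stab _ π).2 h4⟩ =
       sign (subtypePerm π (p := fun x => f (Quotient.mk _ x) = 0) (fun x => by
         have := h4 x
         rw [h5] at this
         simp only at this ⊢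
         rw [this])) := rfl
    rw [h7, sign_eq_cyc, cyc_sub, sg_eq, sg_eq, Nat.card_eq_fintype_card]
    push_cast
    rw [pow_add, ← mul_assoc, ← pow_add, Even.neg_one_pow ⟨_, rfl⟩, one_mul]
  have key2 : (∑ x, if f (Quotient.mk (SameCycle.setoid π) x) = 2 then (1:ℝ) else 0) = ∑ o, if f o = 2 then l o else 0 := by
    rw [hsum fun o => if f o = 2 then (1:ℝ) else 0]
    refine Finset.sum_congr rfl fun o _ => ?_
    split_ifs <;> simp
  have key3 : (∑ x, if f (Quotient.mk (SameCycle.setoid π) x) = 1 then (0:ℝ) else 1) = ∑ o, if f o = 1 then 0 else l o := by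
    rw [hsum fun o => if f o = 1 then (0:ℝ) else 1]
    refine Finset.sum_congr rfl fun o _ => ?_
    split_ifs <;> simp
  have h8 : wt ((invEquiv (Fin 3) π).symm f).1 = sg (fun x => f (Quotient.mk (SameCycle.setoid π) x)) *
    (∑ x, if f (Quotient.mk (SameCycle.setoid π) x) = 2 then (1:ℝ) else 0) /
    (∑ x, if f (Quotient.mk (SameCycle.setoid π) x) = 1 then (0:ℝ) else 1) := rfl
  rw [← key, ← key2, ← key3, h8]
  ring

end Col

end Part5

section Part6

open Equiv Equiv.Perm
set_option linter.unusedSectionVars false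
set_option linter.unusedSimpArgs false

section Cnt

variable {n : ℕ} {r : ℕ} {d : Fin r → ℕ}
  (φ : MonoidAlgebra ℂ (Perm (Fin n)) ≃ₐ[ℂ] (Π i, Matrix (Fin (d i)) (Fin (d i)) ℂ))

theorem count_ec (c : Fin n → Fin 3) : Nat.card {i // φ (ec c) i ≠ 0} ≤ (n+1)^9 := by
  have hlt : ∀ g : Perm (Fin n), ∀ a b, (Finset.univ.filter fun x => c x = a ∧ c (g x) = b).card < n + 1 := by
    intro g a b
    rw [Nat.lt_succ_iff]
    exact (Finset.card_le_univ _).trans (by simp)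
  have := count_ee φ (stab c) (thI c) (T := Fin 3 → Fin 3 → Fin (n+1))
    (fun g a b => ⟨(Finset.univ.filter fun x => c x = a ∧ c (g x) = b).card, hlt g a b⟩) (by
      intro g g' h
      apply dcoset
      intro a b
      have := congrFun (congrFun h a) b
      simpa using this)
  refine this.trans (le_of_eq ?_)
  simp
  ring

theorem count_supp (hd : ∀ i, NeZero (d i)) (w : Fin r → ℂ)
    (hw : ∀ i, φ (mkA fun π => ((cyc π : ℝ) : ℂ)) i = w i • 1) :
    Nat.card {i // w i ≠ 0} ≤ (n+1)^12 := by
  classical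
  let S := Fin 3 → Fin (n+1)
  let F : (Fin n → Fin 3) → S := fun c a => ⟨(Finset.univ.filter fun x => c x = a).card, by
    rw [Nat.lt_succ_iff]
    exact (Finset.card_le_univ _).trans (by simp)⟩
  let C : S → (Fin n → Fin 3) := fun s => if h : ∃ c, F c = s then h.choose else fun _ => 0
  have hC : ∀ c, F (C (F c)) = F c := by
    intro c
    have h : ∃ c', F c' = F c := ⟨c, rfl⟩
    simp only [C]
    rw [dif_pos h]
    exact h.choose_spec
  have hsub : (Finset.univ.filter fun i => w i ≠ 0) ⊆
      Finset.univ.biUnion fun s : S => Finset.univ.filter fun i => φ (ec (C s)) i ≠ 0 := by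
    intro i hi
    have hi := (Finset.mem_filter.1 hi).2
    simp only [Finset.mem_biUnion, Finset.mem_univ, true_and, Finset.mem_filter]
    by_contra hcon
    push Not at hcon
    apply hi
    have hz : φ (mkA fun π => ((cyc π : ℝ) : ℂ)) i = 0 := by
      rw [z_eq, map_sum, Finset.sum_apply]
      refine Finset.sum_eq_zero fun c _ => ?_
      rw [map_smul, Pi.smul_apply]
      obtain ⟨k, hk⟩ := exists_perm_fiber (C (F c)) c (by
        intro a
        have := congrFun (hC c) a
        simpa [F] using this)
      have : c = fun x => C (F c) (k x) := by ext1 x; rw [hk]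
      rw [this, ec_conj, map_mul, map_mul, Pi.mul_apply, Pi.mul_apply, hcon]
      simp
    rw [hw] at hz
    have := hd i
    exact (smul_eq_zero.1 hz).resolve_right one_ne_zero
  rw [Nat.card_eq_fintype_card, Fintype.card_subtype]
  calc _ ≤ _ := Finset.card_le_card hsub
    _ ≤ _ := Finset.card_biUnion_le
    _ ≤ ∑ s : S, (n+1)^9 := by
      refine Finset.sum_le_sum fun s _ => ?_
      have := count_ec φ (C s)
      rwa [Nat.card_eq_fintype_card, Fintype.card_subtype] at this
    _ = _ := by simp [S]; ring

theorem count_pts {ι : Type*} [Fintype ι] [DecidableEq ι] (p : ι → Fin n) (c : Fin n → Option ι)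
    (hc : ∀ x a, c x = some a ↔ x = p a) (θ : stab c →* ℤˣ) :
    Nat.card {i // φ (ee (stab c) θ) i ≠ 0} ≤ (Fintype.card ι + 1) ^ Fintype.card ι := by
  have := count_ee φ (stab c) θ (T := ι → Option ι) (fun g a => c (g (p a))) (by
    intro g g' h
    have hsome : ∀ a b, (Finset.univ.filter fun x => c x = some a ∧ c (g x) = b).card =
      (Finset.univ.filter fun x => c x = some a ∧ c (g' x) = b).card := by
      intro a b
      have h1 : c (g (p a)) = c (g' (p a)) := congrFun h a
      congr 1
      ext x
      simp only [hc, Finset.mem_filter, Finset.mem_univ, true_and]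
      constructor
      · rintro ⟨rfl, h2⟩; exact ⟨rfl, h1 ▸ h2⟩
      · rintro ⟨rfl, h2⟩; exact ⟨rfl, h1 ▸ h2⟩
    have hsum : ∀ (g : Perm (Fin n)) b, (Finset.univ.filter fun x => c x = none ∧ c (g x) = b).card +
       ∑ a, (Finset.univ.filter fun x => c x = some a ∧ c (g x) = b).card = (Finset.univ.filter fun x => c x = b).card := by
      intro g b
      rw [← Fintype.sum_option (f := fun a => (Finset.univ.filter fun x => c x = a ∧ c (g x) = b).card)]
      have h1 : (Finset.univ.filter fun x => c x = b).card = (Finset.univ.filter fun x => c (g x) = b).card := by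
        rw [← Fintype.card_subtype, ← Fintype.card_subtype]
        exact (Fintype.card_congr (Equiv.subtypeEquiv g (by simp))).symm
      rw [h1, Finset.card_eq_sum_card_fiberwise (f := c) (t := Finset.univ) (by simp)]
      refine Finset.sum_congr rfl fun a _ => ?_
      rw [Finset.filter_filter]
      congr 1
      ext x
      simp [and_comm]
    apply dcoset
    intro a b
    rcases a with _ | a
    · have h1 := hsum g b
      have h2 := hsum g' b
      simp only [hsome] at h1
      omega
    · exact hsome a b)
  refine this.trans (le_of_eq ?_)
  simp

end Cnt

end Part6

section Part7

open Equiv Equiv.Perm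
open scoped Matrix
set_option linter.unusedSectionVars false
set_option linter.unusedSimpArgs false

theorem idem_card {ι : Type*} [Fintype ι] {d : ℕ} (E : ι → Matrix (Fin d) (Fin d) ℂ)
    (h0 : ∀ i, E i ≠ 0) (h1 : ∀ i, E i * E i = E i) (h2 : ∀ i j, i ≠ j → E i * E j = 0) :
    Fintype.card ι ≤ d := by
  classical
  have h3 : ∀ i, ∃ v : Fin d → ℂ, E i *ᵥ v ≠ 0 := by
    intro i
    by_contra hcon
    push Not at hcon
    apply h0 i
    ext a b
    have := congrFun (hcon (Pi.single b 1)) a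
    simpa using this
  choose v hv using h3
  have hli : LinearIndependent ℂ (fun i => E i *ᵥ v i) := by
    rw [Fintype.linearIndependent_iff]
    intro c hc i
    have h := congrArg (fun u => E i *ᵥ u) hc
    simp only [Matrix.mulVec_sum, Matrix.mulVec_smul, Matrix.mulVec_mulVec, Matrix.mulVec_zero] at h
    rw [Finset.sum_eq_single i] at h
    · rw [h1] at h
      exact (smul_eq_zero.1 h).resolve_right (hv i)
    · intro j _ hj
      rw [h2 i j hj.symm]; simp
    · simp
  have := hli.fintype_card_le_finrank
  simpa using this

section Blk

variable {R : Type*} [Ring R] [Algebra ℂ R]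

structure Blk (g s : R) : Prop where
  g3 : g * g * g = 1
  s2 : s * s = 1
  sg : s * g = g * g * s

noncomputable def qO (g : R) : R := 1 - (1/3 : ℂ) • (1 + g + g * g)
noncomputable def xO (g s : R) : R := qO g * ((1/2 : ℂ) • (1 + s))

variable {g s : R} (h : Blk g s)
include h

theorem Blk.pg : (1 + g + g * g) * g = 1 + g + g * g := by
  have := h.g3
  rw [add_mul, add_mul, this]; noncomm_ring

theorem Blk.gp : g * (1 + g + g * g) = 1 + g + g * g := by
  have := h.g3
  rw [mul_add, mul_add, ← mul_assoc, this]; noncomm_ring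

theorem Blk.pp : (1 + g + g * g) * (1 + g + g * g) = (3 : ℂ) • (1 + g + g * g) := by
  have h1 := h.pg
  rw [mul_add, mul_add, ← mul_assoc, h1, h1, mul_one]
  module

theorem Blk.qq : qO g * qO g = qO g := by
  unfold qO
  have := h.pp
  rw [sub_mul, mul_sub, mul_sub, smul_mul_smul_comm, this]
  simp only [one_mul, mul_one]
  module

theorem Blk.qp : qO g * (1 + g + g * g) = 0 := by
  unfold qO
  rw [sub_mul, smul_mul_assoc, h.pp]
  simp only [one_mul]
  module

theorem Blk.sgg : s * (g * g) = g * s := by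
  rw [← mul_assoc, h.sg, mul_assoc, h.sg, ← mul_assoc, ← mul_assoc, h.g3, one_mul]

theorem Blk.sq : s * qO g = qO g * s := by
  unfold qO
  rw [mul_sub, sub_mul, mul_smul_comm, smul_mul_assoc, mul_add, mul_add, add_mul, add_mul, h.sgg, h.sg]
  simp only [one_mul, mul_one]
  rw [add_assoc, add_comm (g * g * s), ← add_assoc]

theorem Blk.gq : g * qO g = qO g * g := by
  unfold qO
  rw [mul_sub, sub_mul, mul_smul_comm, smul_mul_assoc, h.pg, h.gp]
  simp

theorem Blk.xx : xO g s * xO g s = xO g s := by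
  have e : (1 + s) * (1 + s) = (2 : ℂ) • (1 + s) := by
    rw [mul_add, add_mul, add_mul, h.s2]; simp only [one_mul, mul_one]; module
  have e2 : (1 + s) * qO g = qO g * (1 + s) := by
    rw [mul_add, add_mul, h.sq]; simp
  unfold xO
  calc qO g * ((1/2 : ℂ) • (1 + s)) * (qO g * ((1/2 : ℂ) • (1 + s)))
      = (1/4 : ℂ) • (qO g * ((1 + s) * qO g) * (1 + s)) := by
        simp only [mul_smul_comm, smul_mul_assoc, smul_smul, mul_assoc]; norm_num
    _ = (1/4 : ℂ) • ((qO g * qO g) * ((1 + s) * (1 + s))) := by rw [e2]; simp only [mul_assoc]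
    _ = _ := by
      rw [h.qq, e]; simp only [mul_smul_comm, smul_smul]; norm_num

theorem Blk.avg : xO g s + g * xO g s * (g * g) + g * g * xO g s * g = (3/2 : ℂ) • qO g := by
  have e1 : g * s * (g * g) = g * g * s := by rw [mul_assoc, h.sgg, ← mul_assoc]
  have e2 : g * g * s * g = g * s := by
    rw [mul_assoc, h.sg, ← mul_assoc, ← mul_assoc, h.g3, one_mul]
  have e3 : ∀ y, g * (qO g * y) * (g * g) = qO g * (g * y * (g * g)) := by
    intro y
    rw [← mul_assoc g, h.gq]; simp only [mul_assoc]
  have e4 : ∀ y, g * g * (qO g * y) * g = qO g * (g * g * y * g) := by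
    intro y
    rw [← mul_assoc (g * g), mul_assoc g g (qO g), h.gq, ← mul_assoc g, h.gq]; simp only [mul_assoc]
  unfold xO
  rw [e3, e4, ← mul_add, ← mul_add]
  simp only [mul_smul_comm, smul_mul_assoc]
  rw [mul_add g, add_mul, e1, mul_add (g*g), add_mul, e2, ← smul_add, ← smul_add]
  have : 1 + s + (g * 1 * (g * g) + g * g * s) + (g * g * 1 * g + g * s) =
    (3:ℂ) • 1 + (1 + g + g * g) * s := by
    rw [mul_one, mul_one, ← mul_assoc, h.g3]
    simp only [add_mul, one_mul]
    module
  rw [this, mul_smul_comm, mul_add, ← mul_assoc, h.qp]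
  simp [smul_smul]
  norm_num

theorem Blk.avgX (X : R) (hg : X * g = g * X) :
    X * xO g s + g * (X * xO g s) * (g * g) + g * g * (X * xO g s) * g = (3/2 : ℂ) • (X * qO g) := by
  rw [← mul_smul_comm, ← h.avg, mul_add, mul_add]
  congr 1
  · congr 1
    simp only [← mul_assoc, hg]
  · simp only [← mul_assoc, hg]
    rw [mul_assoc g g X, ← hg, ← mul_assoc, ← hg]

theorem Blk.A (X : R) (hg : X * g = g * X) (h0 : X * xO g s = 0) : X * qO g = 0 := by
  have := h.avgX X hg
  rw [h0] at this
  simp only [mul_zero, zero_mul, add_zero] at this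
  exact (smul_eq_zero.1 this.symm).resolve_left (by norm_num)

theorem Blk.B (X : R) (hg : X * g = g * X) (h0 : X * (1 - xO g s) = 0) : X = 0 := by
  have h1 := h.avgX X hg
  rw [mul_sub, mul_one, sub_eq_zero] at h0
  rw [← h0] at h1
  have e1 : g * X * (g * g) = X := by
    rw [← hg, mul_assoc, ← mul_assoc g, h.g3, mul_one]
  have e2 : g * g * X * g = X := by
    rw [mul_assoc, hg, ← mul_assoc, h.g3, one_mul]
  rw [e1, e2] at h1
  have h2 : X = (1/2 : ℂ) • (X * qO g) := by
    have : (1/3 : ℂ) • (X + X + X) = (1/3 : ℂ) • ((3/2 : ℂ) • (X * qO g)) := by rw [h1]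
    rw [smul_smul] at this
    rw [← sub_eq_zero] at this ⊢
    rw [← this]
    norm_num
    module
  have h3 : X * qO g = (1/2 : ℂ) • (X * qO g) := by
    have := congrArg (fun y => y * qO g) h2
    simp only [smul_mul_assoc, mul_assoc, h.qq] at this
    exact this
  have h4 : X * qO g = 0 := by
    have : (1/2 : ℂ) • (X * qO g) = 0 := by
      rw [← sub_eq_zero] at h3
      rw [← h3]; module
    rw [h3, this]
  rw [h2, h4, smul_zero]

theorem Blk.fix (X : R) (h0 : X * qO g = 0) : X * g = X := by
  have h1 : X = (1/3 : ℂ) • (X * (1 + g + g * g)) := by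
    unfold qO at h0
    rw [mul_sub, mul_one, sub_eq_zero, mul_smul_comm] at h0
    exact h0
  have h2 := congrArg (fun y => y * g) h1
  simp only [smul_mul_assoc] at h2
  rw [mul_assoc, h.pg, ← h1] at h2
  exact h2

end Blk

end Part7

section Part8

open Equiv Equiv.Perm
set_option linter.unusedSectionVars false
set_option linter.unusedSimpArgs false

section BSys

variable {m : ℕ}

structure BS {R : Type*} [Ring R] [Algebra ℂ R] (g s : Fin m → R) : Prop where
  blk : ∀ c, Blk (g c) (s c)
  gg : ∀ c c', c ≠ c' → Commute (g c) (g c')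
  gs : ∀ c c', c ≠ c' → Commute (g c) (s c')
  ss : ∀ c c', c ≠ c' → Commute (s c) (s c')

theorem comm_q {R : Type*} [Ring R] [Algebra ℂ R] (g y : R) (h : Commute y g) : Commute y (qO g) := by
  unfold qO
  exact (Commute.one_right y).sub_right ((((Commute.one_right y).add_right h).add_right (h.mul_right h)).smul_right _)

theorem comm_x {R : Type*} [Ring R] [Algebra ℂ R] (g s y : R) (h : Commute y g) (h2 : Commute y s) :
    Commute y (xO g s) := by
  unfold xO
  exact (comm_q g y h).mul_right (((Commute.one_right y).add_right h2).smul_right _)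

theorem alg_dim {C : Type*} [CommRing C] {d : ℕ} (f : C →+* Matrix (Fin d) (Fin d) ℂ)
    (g s : Fin m → Matrix (Fin d) (Fin d) ℂ) (hB : BS g s) (q x : Fin m → C)
    (hq : ∀ c, f (q c) = qO (g c)) (hx : ∀ c, f (x c) = xO (g c) (s c)) (k : ℕ)
    (hk : ∀ S : Finset (Fin m), S.card = k → f (∏ c ∈ S, q c) ≠ 0) : m.choose k ≤ d := by
  classical
  let y : Finset (Fin m) → Fin m → C := fun S c => if c ∈ S then x c else 1 - x c
  have hne : ∀ S : Finset (Fin m), S.card = k → f (∏ c, y S c) ≠ 0 := by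
    intro S hS
    let Y : Finset (Fin m) → Fin m → C := fun T c => if c ∈ T then y S c else if c ∈ S then q c else 1
    have key : ∀ T, f (∏ c, Y T c) ≠ 0 := by
      intro T
      induction T using Finset.induction_on with
      | empty =>
        have : ∏ c, Y ∅ c = ∏ c ∈ S, q c := by simp [Y, Finset.prod_ite_mem]
        rw [this]; exact hk S hS
      | insert a T ha ih =>
        rw [← Finset.prod_erase_mul _ _ (Finset.mem_univ a), map_mul] at ih ⊢
        have he : ∏ c ∈ Finset.univ.erase a, Y (insert a T) c = ∏ c ∈ Finset.univ.erase a, Y T c := by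
          refine Finset.prod_congr rfl fun c hc => ?_
          have := Finset.ne_of_mem_erase hc
          simp [Y, this]
        rw [he]
        set X := f (∏ c ∈ Finset.univ.erase a, Y T c) with hX
        have hcomm : Commute (g a) X := by
          rw [hX]
          refine Finset.prod_induction (Y T) (fun z => Commute (g a) (f z)) ?_ ?_ ?_
          · intro u v hu hv; rw [map_mul]; exact hu.mul_right hv
          · rw [map_one]; exact Commute.one_right _
          · intro c hc
            have hca := (Finset.ne_of_mem_erase hc).symm
            have h1 : Commute (g a) (f (q c)) := by rw [hq]; exact comm_q _ _ (hB.gg a c hca)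
            have h2 : Commute (g a) (f (x c)) := by
              rw [hx]; exact comm_x _ _ _ (hB.gg a c hca) (hB.gs a c hca)
            simp only [Y, y]
            split_ifs
            · exact h2
            · rw [map_sub, map_one]; exact (Commute.one_right _).sub_right h2
            · exact h1
            · rw [map_one]; exact Commute.one_right _
        have hY1 : Y (insert a T) a = y S a := by simp [Y]
        have hY2 : Y T a = if a ∈ S then q a else 1 := by simp [Y, ha]
        rw [hY1]
        rw [hY2] at ih
        simp only [y]
        intro h0
        apply ih
        by_cases haS : a ∈ S
        · rw [if_pos haS] at h0 ⊢
          rw [hx] at h0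
          rw [hq]
          exact (hB.blk a).A X hcomm.symm h0
        · rw [if_neg haS] at h0 ⊢
          rw [map_sub, map_one, hx] at h0
          rw [(hB.blk a).B X hcomm.symm h0, zero_mul]
    have := key Finset.univ
    simpa [Y] using this
  have hxx : ∀ c, f (x c) * f (x c) = f (x c) := fun c => by rw [hx]; exact (hB.blk c).xx
  let E : {S : Finset (Fin m) // S.card = k} → Matrix (Fin d) (Fin d) ℂ := fun S => f (∏ c, y S c)
  have h := idem_card E (fun S => hne S.1 S.2) ?_ ?_
  · simpa using h
  · rintro ⟨S, hS⟩
    simp only [E]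
    rw [← map_mul, ← Finset.prod_mul_distrib]
    have : ∀ T : Finset (Fin m), f (∏ c ∈ T, y S c * y S c) = f (∏ c ∈ T, y S c) := by
      intro T
      induction T using Finset.induction_on with
      | empty => simp
      | insert a T ha ih =>
        rw [Finset.prod_insert ha, Finset.prod_insert ha, map_mul, map_mul, ih]
        congr 1
        simp only [y]
        split_ifs
        · rw [map_mul, hxx]
        · rw [map_mul, map_sub, map_one, sub_mul, mul_sub, mul_sub, hxx]; simp
    exact this _
  · rintro ⟨S, hS⟩ ⟨S', hS'⟩ hne'
    simp only [E]
    rw [← map_mul, ← Finset.prod_mul_distrib]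
    obtain ⟨a, ha, ha'⟩ : ∃ a, a ∈ S ∧ a ∉ S' := by
      by_contra hcon
      push Not at hcon
      apply hne'
      rw [Subtype.mk.injEq]
      exact Finset.eq_of_subset_of_card_le hcon (by rw [hS, hS'])
    rw [← Finset.mul_prod_erase _ _ (Finset.mem_univ a), map_mul]
    simp only [y, if_pos ha, if_neg ha']
    rw [map_mul, map_sub, mul_sub, hxx]
    simp

theorem alg_Q {d : ℕ} (g s : Fin m → Matrix (Fin d) (Fin d) ℂ) (hB : BS g s) :
    ∃ Q : Finset (Fin m) → Matrix (Fin d) (Fin d) ℂ, Q ∅ = 1 ∧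
      (∀ S c, c ∉ S → Q (insert c S) = Q S * qO (g c)) ∧
      ∀ k, (∀ S, S.card = k → Q S ≠ 0) → m.choose k ≤ d := by
  have hqq : ∀ c c', Commute (qO (g c)) (qO (g c')) := by
    intro c c'
    rcases eq_or_ne c c' with h | h
    · rw [h]
    · exact comm_q _ _ (comm_q _ _ (hB.gg c' c h.symm)).symm
  have hxx : ∀ c c', Commute (xO (g c) (s c)) (xO (g c') (s c')) := by
    intro c c'
    rcases eq_or_ne c c' with h | h
    · rw [h]
    · exact comm_x _ _ _ (comm_x _ _ _ (hB.gg c' c h.symm) (hB.gs c' c h.symm)).symm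
        (comm_x _ _ _ ((hB.gs c c' h).symm) (hB.ss c' c h.symm)).symm
  have hqx : ∀ c c', Commute (qO (g c)) (xO (g c') (s c')) := by
    intro c c'
    rcases eq_or_ne c c' with h | h
    · subst h
      unfold xO
      refine (hqq c c).mul_right (Commute.smul_right ?_ _)
      exact (Commute.one_right _).add_right ((hB.blk c).sq).symm
    · exact comm_x _ _ _ (comm_q _ _ (hB.gg c' c h.symm)).symm (comm_q _ _ (hB.gs c c' h).symm).symm
  let s0 : Set (Matrix (Fin d) (Fin d) ℂ) := Set.range (fun c => qO (g c)) ∪ Set.range (fun c => xO (g c) (s c))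
  have hs0 : ∀ a ∈ s0, ∀ b ∈ s0, a * b = b * a := by
    rintro a (⟨c, rfl⟩ | ⟨c, rfl⟩) b (⟨c', rfl⟩ | ⟨c', rfl⟩)
    · exact hqq c c'
    · exact hqx c c'
    · exact (hqx c' c).symm
    · exact hxx c c'
  let _ := Algebra.adjoinCommRingOfComm ℂ hs0
  let f : (Algebra.adjoin ℂ s0) →+* Matrix (Fin d) (Fin d) ℂ := (Algebra.adjoin ℂ s0).val.toRingHom
  let q : Fin m → Algebra.adjoin ℂ s0 := fun c => ⟨qO (g c), Algebra.subset_adjoin (Or.inl ⟨c, rfl⟩)⟩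
  let x : Fin m → Algebra.adjoin ℂ s0 := fun c => ⟨xO (g c) (s c), Algebra.subset_adjoin (Or.inr ⟨c, rfl⟩)⟩
  refine ⟨fun S => f (∏ c ∈ S, q c), by simp, ?_, ?_⟩
  · intro S c hc
    simp only
    rw [Finset.prod_insert hc, mul_comm, map_mul]
    rfl
  · intro k hk
    exact alg_dim f g s hB q x (fun _ => rfl) (fun _ => rfl) k hk

end BSys

end Part8

section Part9

open Equiv Equiv.Perm
set_option linter.unusedSectionVars false
set_option linter.unusedSimpArgs false

section Blocks

variable {m : ℕ} {α : Type*} [Fintype α] [DecidableEq α] (b : Fin m × Fin 3 ↪ α)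

def bemb (c : Fin m) : Fin 3 ↪ α := ⟨fun j => b (c, j), fun j j' h => by
  have := b.injective h; simpa using this⟩

noncomputable def bh (c : Fin m) : Perm (Fin 3) →* Perm α := viaEmbeddingHom (bemb b c)

theorem bh_apply (c : Fin m) (e : Perm (Fin 3)) (j : Fin 3) : bh b c e (b (c, j)) = b (c, e j) :=
  viaEmbedding_apply e (bemb b c) j

theorem bh_apply_of (c : Fin m) (e : Perm (Fin 3)) (x : α) (hx : ∀ j, x ≠ b (c, j)) : bh b c e x = x :=
  viaEmbedding_apply_of_notMem e (bemb b c) x (by rintro ⟨j, rfl⟩; exact hx j rfl)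

theorem bh_apply_ne (c c' : Fin m) (hc : c ≠ c') (e : Perm (Fin 3)) (j : Fin 3) :
    bh b c e (b (c', j)) = b (c', j) := by
  apply bh_apply_of
  intro j' h
  have := b.injective h
  simp at this
  exact hc this.1.symm

theorem bh_comm (S : Finset (Fin m)) (k : Perm α) (hk : ∀ c ∈ S, ∀ j, k (b (c, j)) = b (c, j))
    (c : Fin m) (hc : c ∈ S) (e : Perm (Fin 3)) : Commute k (bh b c e) := by
  apply Disjoint.commute
  intro x
  by_cases h : ∃ j, x = b (c, j)
  · obtain ⟨j, rfl⟩ := h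
    exact Or.inl (hk c hc j)
  · push Not at h
    exact Or.inr (bh_apply_of b c e x h)

theorem bh_comm_ne (c c' : Fin m) (h : c ≠ c') (e e' : Perm (Fin 3)) : Commute (bh b c e) (bh b c' e') := by
  refine bh_comm b {c'} _ ?_ c' (by simp) e'
  intro c'' hc'' j
  rw [Finset.mem_singleton.1 hc'']
  exact bh_apply_ne b c c' h e j

noncomputable def bU (τ : Perm (Fin m)) : Perm α := viaEmbeddingHom b (τ.prodCongr (Equiv.refl (Fin 3)))

theorem bU_apply (τ : Perm (Fin m)) (c : Fin m) (j : Fin 3) : bU b τ (b (c, j)) = b (τ c, j) :=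
  viaEmbedding_apply _ b (c, j)

theorem bU_conj (τ : Perm (Fin m)) (c : Fin m) (e : Perm (Fin 3)) :
    bU b τ * bh b c e = bh b (τ c) e * bU b τ := by
  ext x
  simp only [Perm.mul_apply]
  by_cases hx : ∃ p, b p = x
  · obtain ⟨⟨c', j⟩, rfl⟩ := hx
    rw [bU_apply]
    rcases eq_or_ne c c' with h | h
    · subst h
      rw [bh_apply, bh_apply, bU_apply]
    · rw [bh_apply_ne b c c' h, bh_apply_ne b _ _ (fun h' => h (τ.injective h')), bU_apply]
  · have h1 : bU b τ x = x := viaEmbedding_apply_of_notMem _ b x hx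
    have h2 : ∀ c, bh b c e x = x := fun c => bh_apply_of b c e x (fun j h => hx ⟨_, h.symm⟩)
    rw [h2, h1, h2]

theorem bh_cycleType (c : Fin m) : (bh b c (finRotate 3)).cycleType = {3} := by
  classical
  rw [← cycleType_finRotate (n := 1)]
  have := cycleType_extendDomain (Equiv.ofInjective (bemb b c) (bemb b c).injective) (g := finRotate 3)
  simp only [bh, viaEmbeddingHom_apply, viaEmbedding]
  convert this <;> rfl

variable {d : ℕ} (ρ : Perm α →* Matrix (Fin d) (Fin d) ℂ)

theorem commute_map {x y : Perm α} (h : Commute x y) : Commute (ρ x) (ρ y) := h.map ρ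

theorem bs_rho : BS (fun c => ρ (bh b c (finRotate 3))) (fun c => ρ (bh b c (swap 0 1))) where
  blk c := by
    constructor
    · rw [← map_mul, ← map_mul, ← map_mul, ← map_mul, show finRotate 3 * finRotate 3 * finRotate 3 = 1 by decide, map_one, map_one]
    · rw [← map_mul, ← map_mul, show (swap 0 1 : Perm (Fin 3)) * swap 0 1 = 1 by decide, map_one, map_one]
    · simp only [← map_mul]
      rw [show (swap 0 1 : Perm (Fin 3)) * finRotate 3 = finRotate 3 * finRotate 3 * swap 0 1 by decide]
  gg c c' h := commute_map ρ (bh_comm_ne b c c' h _ _)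
  gs c c' h := commute_map ρ (bh_comm_ne b c c' h _ _)
  ss c c' h := commute_map ρ (bh_comm_ne b c c' h _ _)

variable (Q : Finset (Fin m) → Matrix (Fin d) (Fin d) ℂ) (hQ0 : Q ∅ = 1)
  (hQ1 : ∀ S c, c ∉ S → Q (insert c S) = Q S * qO (ρ (bh b c (finRotate 3))))
include hQ0 hQ1

theorem Q_comm (S : Finset (Fin m)) (k : Perm α) (hk : ∀ c ∈ S, ∀ j, k (b (c, j)) = b (c, j)) :
    Commute (ρ k) (Q S) := by
  induction S using Finset.induction_on with
  | empty => rw [hQ0]; exact Commute.one_right _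
  | insert c S hc ih =>
    rw [hQ1 S c hc]
    refine (ih fun c' hc' => hk c' (Finset.mem_insert_of_mem hc')).mul_right (comm_q _ _ ?_)
    exact commute_map ρ (bh_comm b (insert c S) k hk c (by simp) _)

theorem Q_conj (τ : Perm (Fin m)) (S : Finset (Fin m)) :
    ρ (bU b τ) * Q S = Q (S.map τ.toEmbedding) * ρ (bU b τ) := by
  induction S using Finset.induction_on with
  | empty => simp [hQ0]
  | insert c S hc ih =>
    have hc' : τ c ∉ S.map τ.toEmbedding := by simpa using hc
    have e : (insert c S).map τ.toEmbedding = insert (τ c) (S.map τ.toEmbedding) := by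
      rw [Finset.map_insert]; rfl
    rw [e, hQ1 _ _ hc', hQ1 _ _ hc, ← mul_assoc, ih, mul_assoc, mul_assoc]
    congr 1
    have h1 : ρ (bU b τ) * ρ (bh b c (finRotate 3)) = ρ (bh b (τ c) (finRotate 3)) * ρ (bU b τ) := by
      rw [← map_mul, ← map_mul, bU_conj]
    unfold qO
    rw [mul_sub, sub_mul, mul_one, one_mul, mul_smul_comm, smul_mul_assoc, mul_add, mul_add, add_mul, add_mul,
      ← mul_assoc, h1, mul_one, one_mul, mul_assoc, h1, ← mul_assoc]

theorem Q_even (S : Finset (Fin m)) (c : Fin m) (hc : c ∉ S) (h0 : Q S * qO (ρ (bh b c (finRotate 3))) = 0)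
    (h : Perm α) (hh : ∀ c ∈ S, ∀ j, h (b (c, j)) = b (c, j)) (hs : sign h = 1) : Q S * ρ h = Q S := by
  classical
  let p : α → Prop := fun x => ∀ c ∈ S, ∀ j, x ≠ b (c, j)
  have hfix : ∀ (k : Perm α), (∀ c ∈ S, ∀ j, k (b (c, j)) = b (c, j)) → 
     (∀ x, p (k x) ↔ p x) ∧ (∀ x, k x ≠ x → p x) := by
    intro k hk
    constructor
    · intro x
      constructor
      · rintro h1 c hc j rfl
        exact h1 c hc j (hk c hc j)
      · intro h1 c hc j h2
        apply h1 c hc j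
        apply k.injective
        rw [h2, hk c hc j]
    · rintro x hx c hc j rfl
      exact hx (hk c hc j)
  have hsub : ∀ (k : Perm (Subtype p)), ∀ c ∈ S, ∀ j, ofSubtype k (b (c, j)) = b (c, j) := by
    intro k c hc j
    apply ofSubtype_apply_of_not_mem
    intro h; exact h c hc j rfl
  have hg := hfix (bh b c (finRotate 3)) (fun c' hc' j => bh_apply_ne b c c' (by rintro rfl; exact hc hc') _ j)
  have hX := ((bs_rho b ρ).blk c).fix (Q S) h0
  set g' : Perm (Subtype p) := subtypePerm (bh b c (finRotate 3)) hg.1 with hg'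
  have hog : ofSubtype g' = bh b c (finRotate 3) := ofSubtype_subtypePerm hg.1 hg.2
  have key : ∀ k ∈ alternatingGroup (Subtype p), Q S * ρ (ofSubtype k) = Q S := by
    intro k hk
    rw [← closure_three_cycles_eq_alternating] at hk
    induction hk using Subgroup.closure_induction with
    | mem x hx =>
      have hct : g'.cycleType = x.cycleType := by
        rw [show x.cycleType = {3} from hx, ← cycleType_ofSubtype, hog, bh_cycleType]
      obtain ⟨t, ht⟩ := isConj_iff.1 (isConj_iff_cycleType_eq.2 hct)
      have hcm := Q_comm b ρ Q hQ0 hQ1 S (ofSubtype t) (hsub t)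
      rw [← ht, map_mul, map_mul, map_mul, map_mul, hog, ← mul_assoc, ← mul_assoc, ← hcm.eq, mul_assoc (ρ _) (Q S), hX,
        hcm.eq, mul_assoc, ← map_mul, ← map_mul, mul_inv_cancel, map_one, map_one, mul_one]
    | one => simp
    | mul x y _ _ hx hy => rw [map_mul, map_mul, ← mul_assoc, hx, hy]
    | inv x _ hx =>
      rw [← hx, mul_assoc, ← map_mul, ← map_mul]
      simp [hx]
  have hh2 := hfix h hh
  have := key (subtypePerm h hh2.1) (by
    rw [mem_alternatingGroup, ← sign_ofSubtype, ofSubtype_subtypePerm hh2.1 hh2.2, hs])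
  rwa [ofSubtype_subtypePerm hh2.1 hh2.2] at this

theorem Q_zero (h1 : (1 : Matrix (Fin d) (Fin d) ℂ) ≠ 0) (S0 : Finset (Fin m)) (h : Q S0 = 0) :
    ∃ S c, S ⊆ S0 ∧ c ∉ S ∧ Q S ≠ 0 ∧ Q S * qO (ρ (bh b c (finRotate 3))) = 0 := by
  induction S0 using Finset.induction_on with
  | empty => exact absurd (hQ0.symm.trans h) h1
  | insert c S hc ih =>
    by_cases hS : Q S = 0
    · obtain ⟨S', c', h⟩ := ih hS
      exact ⟨S', c', h.1.trans (Finset.subset_insert _ _), h.2⟩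
    · exact ⟨S, c, Finset.subset_insert _ _, hc, hS, by rw [← hQ1 S c hc, h]⟩

end Blocks

end Part9

section Part10

open Equiv Equiv.Perm
set_option linter.unusedSectionVars false
set_option linter.unusedSimpArgs false

section L2

variable {n : ℕ} {r : ℕ} {d : Fin r → ℕ}
  (φ : MonoidAlgebra ℂ (Perm (Fin n)) ≃ₐ[ℂ] (Π i, Matrix (Fin (d i)) (Fin (d i)) ℂ))

noncomputable def rhoI (i : Fin r) : Perm (Fin n) →* Matrix (Fin (d i)) (Fin (d i)) ℂ where
  toFun g := φ (MonoidAlgebra.single g 1) i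
  map_one' := by
    rw [← MonoidAlgebra.one_def, map_one, Pi.one_apply]
  map_mul' g h := by
    rw [← Pi.mul_apply, ← map_mul, MonoidAlgebra.single_mul_single, one_mul]

abbrev PtI {m : ℕ} (S : Finset (Fin m)) := {c // c ∈ S} × Fin 3

theorem exists_col {m : ℕ} (b : Fin m × Fin 3 ↪ Fin n) (S : Finset (Fin m)) :
    ∃ c : Fin n → Option (PtI S), ∀ x a, c x = some a ↔ x = b (a.1, a.2) := by
  classical
  refine ⟨fun x => if h : ∃ a : PtI S, x = b (a.1, a.2) then some h.choose else none, ?_⟩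
  intro x a
  by_cases h : ∃ a : PtI S, x = b (a.1, a.2)
  · simp only [h, dite_true, Option.some.injEq]
    have := h.choose_spec
    constructor
    · intro h2; rw [← h2]; exact this
    · intro h2
      have := b.injective (h2.symm.trans this)
      simp only [Prod.mk.injEq] at this
      ext1
      · exact Subtype.ext this.1.symm
      · exact this.2.symm
  · simp only [h, dite_false]
    push Not at h
    simpa using h a

def sgK {β : Type*} [DecidableEq β] (c : Fin n → β) : stab c →* ℤˣ := Perm.sign.comp (stab c).subtype

theorem phi_ee {β : Type*} [DecidableEq β] (c : Fin n → β) (θ : stab c →* ℤˣ) (i : Fin r) :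
    φ (ee (stab c) θ) i = ∑ h : stab c, ((θ h : ℤ) : ℂ) • rhoI φ i h := by
  rw [ee, map_sum, Finset.sum_apply]
  refine Finset.sum_congr rfl fun h _ => ?_
  rw [map_smul]; rfl

theorem l2 {m : ℕ} (b : Fin m × Fin 3 ↪ Fin n) (i : Fin r)
    (Q : Finset (Fin m) → Matrix (Fin (d i)) (Fin (d i)) ℂ) (hQ0 : Q ∅ = 1)
    (hQ1 : ∀ S c, c ∉ S → Q (insert c S) = Q S * qO (rhoI φ i (bh b c (finRotate 3))))
    (S0 S : Finset (Fin m)) (hS : S ⊆ S0) (c : Fin m) (hc : c ∉ S) (hne : Q S ≠ 0)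
    (h0 : Q S * qO (rhoI φ i (bh b c (finRotate 3))) = 0)
    (col : Fin n → Option (PtI S0)) (hcol : ∀ x a, col x = some a ↔ x = b (a.1, a.2)) :
    φ (ee (stab col) 1) i ≠ 0 ∨ φ (ee (stab col) (sgK col)) i ≠ 0 := by
  by_contra hcon
  push Not at hcon
  obtain ⟨h1, h2⟩ := hcon
  rw [phi_ee] at h1 h2
  have hfix : ∀ h : stab col, ∀ c ∈ S, ∀ j, (h : Perm (Fin n)) (b (c, j)) = b (c, j) := by
    intro h c hc j
    have e1 : col (b (c, j)) = some (⟨c, hS hc⟩, j) := (hcol _ _).2 rfl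
    have e2 := h.2 (b (c, j))
    rw [e1] at e2
    exact (hcol _ _).1 e2
  have key : ∀ h : stab col, Q S * (((((1 : stab col →* ℤˣ) h : ℤˣ) : ℤ) : ℂ) • rhoI φ i h + (((sgK col h : ℤˣ) : ℤ) : ℂ) • rhoI φ i h)
      = (((1 + ((sign (h : Perm (Fin n)) : ℤˣ) : ℤ) : ℤ) : ℂ)) • Q S := by
    intro h
    rcases Int.units_eq_one_or (sign (h : Perm (Fin n))) with hs | hs
    · have := Q_even b (rhoI φ i) Q hQ0 hQ1 S c hc h0 h (hfix h) hs
      have e : sgK col h = 1 := hs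
      rw [e, hs, MonoidHom.one_apply]
      simp only [Units.val_one, Int.cast_one, one_smul, mul_add, this, Int.cast_add, add_smul]
    · have e : sgK col h = -1 := hs
      rw [e, hs, MonoidHom.one_apply]
      simp
  have hsum : (∑ h : stab col, ((1 + ((sign (h : Perm (Fin n)) : ℤˣ) : ℤ) : ℤ) : ℂ)) • Q S = 0 := by
    rw [Finset.sum_smul]
    simp only [← key]
    rw [← Finset.mul_sum, Finset.sum_add_distrib, h1, h2, add_zero, mul_zero]
  rcases smul_eq_zero.1 hsum with h | h
  · rw [← Int.cast_sum, Int.cast_eq_zero] at h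
    have := (Finset.sum_eq_zero_iff_of_nonneg (by
      intro x _
      rcases Int.units_eq_one_or (sign (x : Perm (Fin n))) with hs | hs <;> simp [hs])).1 h 1 (by simp)
    simp at this
  · exact hne h

theorem tri {m : ℕ} (b : Fin m × Fin 3 ↪ Fin n) (hd : ∀ i, NeZero (d i)) (i : Fin r) (S0 : Finset (Fin m))
    (col0 : Fin n → Option (PtI (∅ : Finset (Fin m)))) (hcol0 : ∀ x a, col0 x = some a ↔ x = b (a.1, a.2))
    (col : Fin n → Option (PtI S0)) (hcol : ∀ x a, col x = some a ↔ x = b (a.1, a.2)) :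
    (φ (ee (stab col0) 1) i ≠ 0 ∨ φ (ee (stab col0) (sgK col0)) i ≠ 0) ∨ m.choose S0.card ≤ d i ∨
    (m ≤ d i ∧ (φ (ee (stab col) 1) i ≠ 0 ∨ φ (ee (stab col) (sgK col)) i ≠ 0)) := by
  obtain ⟨Q, hQ0, hQ1, hQ2⟩ := alg_Q _ _ (bs_rho b (rhoI φ i))
  have := hd i
  have hone : (1 : Matrix (Fin (d i)) (Fin (d i)) ℂ) ≠ 0 := one_ne_zero
  by_cases h1 : ∃ c, Q {c} = 0
  · left
    obtain ⟨c, hc⟩ := h1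
    refine l2 φ b i Q hQ0 hQ1 ∅ ∅ (le_refl _) c (by simp) (by rwa [hQ0]) ?_ col0 hcol0
    rw [← hQ1 _ _ (by simp)]
    simpa using hc
  · right
    push Not at h1
    by_cases h2 : ∀ S, S.card = S0.card → Q S ≠ 0
    · exact Or.inl (hQ2 _ h2)
    · right
      constructor
      · have := hQ2 1 (by
          intro S hS
          obtain ⟨c, rfl⟩ := Finset.card_eq_one.1 hS
          exact h1 c)
        simpa using this
      · push Not at h2
        obtain ⟨S1, hS1, hz⟩ := h2
        obtain ⟨τ, hτ⟩ := exists_perm_fiber (fun x => decide (x ∈ S1)) (fun x => decide (x ∈ S0)) (by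
          intro a
          cases a
          · simp only [decide_eq_false_iff_not]
            have e : ∀ S : Finset (Fin m), (Finset.univ.filter fun x => x ∉ S) = Sᶜ := by intro S; ext; simp
            rw [e, e, Finset.card_compl, Finset.card_compl, hS1]
          · simpa using hS1)
        have hmap : S0.map τ.toEmbedding = S1 := by
          apply Finset.eq_of_subset_of_card_le
          · intro x hx
            obtain ⟨y, hy, rfl⟩ := Finset.mem_map.1 hx
            have := hτ y
            simp only [decide_eq_decide] at this
            exact this.2 hy
          · simp [hS1]
        have hQz := Q_conj b (rhoI φ i) Q hQ0 hQ1 τ S0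
        rw [hmap, hz, zero_mul] at hQz
        have hQS0 : Q S0 = 0 := by
          have e : rhoI φ i (bU b τ)⁻¹ * rhoI φ i (bU b τ) = 1 := by rw [← map_mul]; simp
          rw [← one_mul (Q S0), ← e, mul_assoc, hQz, mul_zero]
        obtain ⟨S, c, hS, hc, hne, h0⟩ := Q_zero b (rhoI φ i) Q hQ0 hQ1 hone S0 hQS0
        exact l2 φ b i Q hQ0 hQ1 S0 S hS c hc hne h0 col hcol

end L2

end Part10

section Part11

open Equiv Equiv.Perm
set_option linter.unusedSectionVars false
set_option linter.unusedSimpArgs false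

section Fin1

variable {n : ℕ} {r : ℕ} {d : Fin r → ℕ}
  (φ : MonoidAlgebra ℂ (Perm (Fin n)) ≃ₐ[ℂ] (Π i, Matrix (Fin (d i)) (Fin (d i)) ℂ))

theorem z_central (g : Perm (Fin n)) :
    MonoidAlgebra.single g 1 * mkA (fun π : Perm (Fin n) => ((cyc π : ℝ) : ℂ)) =
      mkA (fun π : Perm (Fin n) => ((cyc π : ℝ) : ℂ)) * MonoidAlgebra.single g 1 := by
  rw [mkA_eq, Finset.mul_sum, Finset.sum_mul, ← Equiv.sum_comp (MulAut.conj g).toEquiv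
    (fun x => (((cyc x : ℝ) : ℂ) • MonoidAlgebra.single x (1:ℂ)) * MonoidAlgebra.single g 1)]
  refine Finset.sum_congr rfl fun x _ => ?_
  have e : (MulAut.conj g).toEquiv x = g * x * g⁻¹ := rfl
  rw [e, cyc_conj, mul_smul_comm, smul_mul_assoc, MonoidAlgebra.single_mul_single, MonoidAlgebra.single_mul_single]
  simp

theorem w_of_ee {β : Type*} [DecidableEq β] (c : Fin n → β) (hc : ∀ h, h ∈ stab c) (θ : stab c →* ℤˣ)
    (w : Fin r → ℂ) (hw : ∀ i, φ (mkA fun π => ((cyc π : ℝ) : ℂ)) i = w i • 1) (i : Fin r)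
    (hi : φ (ee (stab c) θ) i ≠ 0) :
    w i = ∑ h : Perm (Fin n), ((cyc h : ℝ) : ℂ) * ((θ ⟨h, hc h⟩ : ℤ) : ℂ) := by
  have h1 : mkA (fun π : Perm (Fin n) => ((cyc π : ℝ) : ℂ)) * ee (stab c) θ =
    (∑ h : Perm (Fin n), ((cyc h : ℝ) : ℂ) * ((θ ⟨h, hc h⟩ : ℤ) : ℂ)) • ee (stab c) θ := by
    rw [mkA_eq, Finset.sum_mul, Finset.sum_smul]
    refine Finset.sum_congr rfl fun h _ => ?_
    have := s_mul_ee (stab c) θ ⟨h, hc h⟩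
    rw [smul_mul_assoc, this, smul_smul]
  have h2 := congrFun (congrArg φ h1) i
  rw [map_mul, Pi.mul_apply, hw, map_smul, Pi.smul_apply, smul_mul_assoc, one_mul] at h2
  exact smul_left_injective ℂ hi h2

theorem w_le (hd : ∀ i, NeZero (d i)) (w : Fin r → ℂ)
    (hw : ∀ i, φ (mkA fun π => ((cyc π : ℝ) : ℂ)) i = w i • 1) (i : Fin r) (D : ℕ) (hD : 0 < D) (hDd : D ≤ d i) :
    ‖w i‖ ≤ n.factorial * √(2 * (n + 1)) / D := by
  have h1 := omega_bound φ hd (fun π => (cyc π : ℝ)) (fun g => by rw [cyc_inv]) w hw i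
  have h2 := sum_cyc_sq_le n
  rw [Fintype.card_perm, Fintype.card_fin] at h1
  have hD' : (0:ℝ) < D := by exact_mod_cast hD
  have hDd' : (D:ℝ) ≤ d i := by exact_mod_cast hDd
  rw [le_div_iff₀ hD']
  apply le_of_sq_le_sq _ (by positivity)
  rw [mul_pow, mul_pow, Real.sq_sqrt (by positivity)]
  rw [Nat.factorial_succ] at h2
  push_cast at h2
  calc ‖w i‖^2 * (D:ℝ)^2 ≤ ‖w i‖^2 * (d i:ℝ)^2 := by gcongr
    _ ≤ n.factorial * (∑ π : Perm (Fin n), (cyc π:ℝ)^2) := by linarith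
    _ ≤ n.factorial * (2 * ((n+1) * n.factorial)) := by gcongr
    _ = _ := by ring

theorem main_w {N m : ℕ} {r : ℕ} {d : Fin r → ℕ}
    (φ : MonoidAlgebra ℂ (Perm (Fin (N+2))) ≃ₐ[ℂ] (Π i, Matrix (Fin (d i)) (Fin (d i)) ℂ))
    (hd : ∀ i, NeZero (d i)) (b : Fin m × Fin 3 ↪ Fin (N+2)) (hm : 0 < m) (S0 : Finset (Fin m)) (w : Fin r → ℂ)
    (hw : ∀ i, φ (mkA fun π => ((cyc π : ℝ) : ℂ)) i = w i • 1) :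
    ‖∑ i, w i - ((((N+2).factorial * (harmonic (N+2) : ℝ) : ℝ)) : ℂ)‖ ≤ N.factorial +
      ((N+2+1)^12 : ℕ) * ((N+2).factorial * √(2 * ((N+2 : ℕ) + 1)) / (m.choose S0.card : ℕ)) +
      2 * (((3 * S0.card + 1) ^ (3 * S0.card) : ℕ) * ((N+2).factorial * √(2 * ((N+2 : ℕ) + 1)) / m)) := by
  classical
  obtain ⟨col0, hcol0⟩ := exists_col b ∅
  obtain ⟨col, hcol⟩ := exists_col b S0
  have hst : ∀ h, h ∈ stab col0 := fun h x => Subsingleton.elim _ _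
  have hcnt0 : ∀ θ, Nat.card {i // φ (ee (stab col0) θ) i ≠ 0} ≤ 1 := by
    intro θ
    have := count_pts φ (fun a : PtI (∅ : Finset (Fin m)) => b (a.1, a.2)) col0 hcol0 θ
    simpa using this
  have hcnt : ∀ θ, Nat.card {i // φ (ee (stab col) θ) i ≠ 0} ≤ (3 * S0.card + 1) ^ (3 * S0.card) := by
    intro θ
    have := count_pts φ (fun a : PtI S0 => b (a.1, a.2)) col hcol θ
    have e : Fintype.card (PtI S0) = 3 * S0.card := by
      simp [PtI, mul_comm]
    rwa [e] at this
  have hEne : ee (stab col0) 1 ≠ 0 := by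
    intro h
    have h1 := ee_coeff (stab col0) 1 1
    rw [h] at h1
    simp [hst] at h1
  obtain ⟨i0, hi0⟩ : ∃ i, φ (ee (stab col0) 1) i ≠ 0 := by
    by_contra hcon
    push Not at hcon
    apply hEne
    apply φ.injective
    rw [map_zero]
    exact funext hcon
  have hw0 : w i0 = ((((N+2).factorial * (harmonic (N+2) : ℝ) : ℝ)) : ℂ) := by
    rw [w_of_ee φ col0 hst 1 w hw i0 hi0, ← sum_cyc]
    push_cast
    simp
  have huniq : ∀ i, φ (ee (stab col0) 1) i ≠ 0 → i = i0 := by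
    intro i hi
    have := Finite.card_le_one_iff_subsingleton.1 (hcnt0 1)
    exact congrArg Subtype.val (Subsingleton.elim (⟨i, hi⟩ : {i // φ (ee (stab col0) 1) i ≠ 0}) ⟨i0, hi0⟩)
  have hsgn : ∀ i, φ (ee (stab col0) (sgK col0)) i ≠ 0 → ‖w i‖ = N.factorial := by
    intro i hi
    rw [w_of_ee φ col0 hst _ w hw i hi, ← sum_sign_cyc N, ← Real.norm_eq_abs, ← Complex.norm_real]
    congr 1
    push_cast
    refine Finset.sum_congr rfl fun h _ => ?_
    rw [mul_comm]
    rfl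
  set X : ℝ := (N+2).factorial * √(2 * ((N+2 : ℕ) + 1)) / (m.choose S0.card : ℕ) with hX
  set Y : ℝ := (N+2).factorial * √(2 * ((N+2 : ℕ) + 1)) / m with hY
  have hX0 : 0 ≤ X := by positivity
  have hY0 : 0 ≤ Y := by positivity
  have hch : 0 < m.choose S0.card := Nat.choose_pos (by simpa using S0.card_le_univ)
  have hpt : ∀ i, i ≠ i0 → ‖w i‖ ≤ (if φ (ee (stab col0) (sgK col0)) i ≠ 0 then (N.factorial : ℝ) else 0) +
      (if w i ≠ 0 then X else 0) + ((if φ (ee (stab col) 1) i ≠ 0 then Y else 0) +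
       (if φ (ee (stab col) (sgK col)) i ≠ 0 then Y else 0)) := by
    intro i hi
    have hn : ∀ (p : Prop) [Decidable p] (x : ℝ), 0 ≤ x → 0 ≤ (if p then x else 0) := by
      intro p _ x hx; split_ifs <;> simp [hx]
    have n1 := hn (φ (ee (stab col0) (sgK col0)) i ≠ 0) N.factorial (by positivity)
    have n2 := hn (w i ≠ 0) X hX0
    have n3 := hn (φ (ee (stab col) 1) i ≠ 0) Y hY0
    have n4 := hn (φ (ee (stab col) (sgK col)) i ≠ 0) Y hY0
    by_cases hwi : w i = 0
    · rw [hwi, norm_zero]; rw [hwi] at n2; positivity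
    rcases tri φ b hd i S0 col0 hcol0 col hcol with (h | h) | h | ⟨h1, h⟩
    · exact absurd (huniq i h) hi
    · rw [if_pos h, hsgn i h]; linarith
    · have := w_le φ hd w hw i _ hch h
      rw [if_pos hwi]
      linarith
    · have := w_le φ hd w hw i _ hm h1
      rcases h with h | h
      · rw [if_pos h]; rw [if_pos h] at n3; linarith
      · rw [if_pos h]; rw [if_pos h] at n4; linarith
  have hcs : ∀ (p : Fin r → Prop) [DecidablePred p] (x : ℝ) (K : ℕ), 0 ≤ x → Nat.card {i // p i} ≤ K →
      ∑ i, (if p i then x else 0) ≤ K * x := by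
    intro p _ x K hx hK
    rw [← Finset.sum_filter, Finset.sum_const, nsmul_eq_mul]
    rw [Nat.card_eq_fintype_card, Fintype.card_subtype] at hK
    gcongr
  rw [← Finset.add_sum_erase _ _ (Finset.mem_univ i0), hw0, add_sub_cancel_left]
  calc _ ≤ ∑ i ∈ Finset.univ.erase i0, ‖w i‖ := norm_sum_le _ _
    _ ≤ ∑ i ∈ Finset.univ.erase i0, _ := Finset.sum_le_sum fun i hi => hpt i (Finset.ne_of_mem_erase hi)
    _ ≤ ∑ i, _ := Finset.sum_le_sum_of_subset_of_nonneg (Finset.subset_univ _) (by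
        intro i _ _
        have hn : ∀ (p : Prop) [Decidable p] (x : ℝ), 0 ≤ x → 0 ≤ (if p then x else 0) := by
          intro p _ x hx; split_ifs <;> simp [hx]
        exact add_nonneg (add_nonneg (hn _ _ (by positivity)) (hn _ _ hX0)) (add_nonneg (hn _ _ hY0) (hn _ _ hY0)))
    _ ≤ _ := by
      rw [Finset.sum_add_distrib, Finset.sum_add_distrib, Finset.sum_add_distrib]
      have a1 := hcs (fun i => φ (ee (stab col0) (sgK col0)) i ≠ 0) N.factorial 1 (by positivity) (hcnt0 _)
      have a2 := hcs (fun i => w i ≠ 0) X _ hX0 (count_supp φ hd w hw)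
      have a3 := hcs (fun i => φ (ee (stab col) 1) i ≠ 0) Y _ hY0 (hcnt _)
      have a4 := hcs (fun i => φ (ee (stab col) (sgK col)) i ≠ 0) Y _ hY0 (hcnt _)
      rw [Nat.cast_one, one_mul] at a1
      linarith

end Fin1

end Part11

section Part12

open Equiv Equiv.Perm
set_option linter.unusedSectionVars false
set_option linter.unusedSimpArgs false

section Fin2

noncomputable def expC (n : ℕ) : ℝ :=
  (∑ σ : Perm (Fin n), ∑ τ : Perm (Fin n), (cyc (σ * τ * σ⁻¹ * τ⁻¹) : ℝ)) / (n.factorial : ℝ) ^ 2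

theorem expGenus_eq (n : ℕ) : expGenus n = n / 2 - expC n / 2 + 1 := by
  have hf : (n.factorial : ℝ) ≠ 0 := by positivity
  unfold expGenus expC
  simp only [numCycles_eq, Finset.sum_add_distrib, Finset.sum_sub_distrib, Finset.sum_const, Finset.card_univ,
    Fintype.card_perm, Fintype.card_fin, nsmul_eq_mul, ← Finset.sum_div]
  field_simp

theorem expC_bound {N m : ℕ} (b : Fin m × Fin 3 ↪ Fin (N+2)) (hm : 0 < m) (S0 : Finset (Fin m)) :
    |expC (N+2) - (harmonic (N+2) : ℝ)| ≤ 1 / ((N+2) * (N+1)) +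
      ((N+2+1)^12 : ℕ) * (√(2 * ((N+2 : ℕ) + 1)) / (m.choose S0.card : ℕ)) +
      2 * (((3 * S0.card + 1) ^ (3 * S0.card) : ℕ) * (√(2 * ((N+2 : ℕ) + 1)) / m)) := by
  classical
  obtain ⟨r, d, hd, ⟨φ⟩⟩ := IsSemisimpleRing.exists_algEquiv_pi_matrix_of_isAlgClosed ℂ (MonoidAlgebra ℂ (Perm (Fin (N+2))))
  obtain ⟨w, hw⟩ := central_scalar φ hd _ (z_central (n := N+2))
  have h1 := main_w φ hd b hm S0 w hw
  have h2 := omega_sum φ hd _ w hw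
  simp only [mkA_coeff] at h2
  rw [Fintype.card_perm, Fintype.card_fin] at h2
  set F : ℝ := ((N+2).factorial : ℝ) with hF
  have hF0 : 0 < F := by positivity
  have h3 : ∑ i, w i = ((F * expC (N+2) : ℝ) : ℂ) := by
    have hFc : (((N+2).factorial : ℕ) : ℂ) ≠ 0 := by exact_mod_cast (Nat.factorial_ne_zero _)
    apply mul_left_cancel₀ hFc
    rw [h2]
    have : F * (F * expC (N+2)) = ∑ σ : Perm (Fin (N+2)), ∑ τ : Perm (Fin (N+2)), (cyc (σ * τ * σ⁻¹ * τ⁻¹) : ℝ) := by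
      unfold expC; rw [← hF]; field_simp
    have h4 : (((N+2).factorial : ℕ) : ℂ) = ((F : ℝ) : ℂ) := by simp [hF]
    rw [h4, ← Complex.ofReal_mul, this]
    push_cast; rfl
  rw [h3, ← Complex.ofReal_sub, Complex.norm_real, Real.norm_eq_abs, ← mul_sub, abs_mul, abs_of_pos hF0] at h1
  have hNF : (N.factorial : ℝ) = F * (1 / ((N+2) * (N+1))) := by
    rw [hF, Nat.factorial_succ, Nat.factorial_succ]; push_cast; field_simp; ring
  rw [hNF] at h1
  refine le_of_mul_le_mul_left (h1.trans (le_of_eq ?_)) hF0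
  ring

theorem expC_asymp : ∃ C : ℝ, ∀ n : ℕ, 90 ≤ n → |expC n - (harmonic n : ℝ)| ≤ C / √((n / 3 : ℕ) : ℝ) := by
  refine ⟨1 + 6^12 * 4 * (Nat.factorial 13 * 2^13) + 2 * (((3 * 13 + 1) ^ (3 * 13) : ℕ) * 4), ?_⟩
  intro n hn
  obtain ⟨N, rfl⟩ : ∃ N, n = N + 2 := ⟨n - 2, by omega⟩
  set m := (N + 2) / 3 with hm
  have hm1 : 30 ≤ m := by omega
  have hm2 : N + 2 + 1 ≤ 6 * m := by omega
  have hm3 : m ≤ N + 2 := by omega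
  obtain ⟨b⟩ : Nonempty (Fin m × Fin 3 ↪ Fin (N+2)) := Function.Embedding.nonempty_of_card_le (by
    simp; omega)
  obtain ⟨S0, -, hS0⟩ := Finset.exists_subset_card_eq (s := (Finset.univ : Finset (Fin m))) (n := 13) (by simp; omega)
  have h := expC_bound b (by omega) S0
  rw [hS0] at h
  set s : ℝ := √(m : ℝ) with hs
  have hss : s ^ 2 = m := Real.sq_sqrt (by positivity)
  have hmR : (30 : ℝ) ≤ m := by exact_mod_cast hm1
  have hs1 : 1 ≤ s := by
    rw [hs]; exact Real.one_le_sqrt.2 (by linarith)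
  have hm2R : ((N + 2 : ℕ) : ℝ) + 1 ≤ 6 * m := by exact_mod_cast hm2
  have hm3R : (m : ℝ) ≤ (N : ℝ) + 2 := by exact_mod_cast hm3
  have hsq : √(2 * (((N+2 : ℕ) : ℝ) + 1)) ≤ 4 * s := by
    apply Real.sqrt_le_iff.2 ⟨by positivity, ?_⟩
    rw [mul_pow, hss]; linarith
  have hchoose : (m : ℝ)^13 / (Nat.factorial 13 * 2^13) ≤ (m.choose 13 : ℕ) := by
    have h1 := Nat.pow_le_choose (α := ℝ) 13 m
    have h2 : (m : ℝ) / 2 ≤ ((m + 1 - 13 : ℕ) : ℝ) := by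
      have : m ≤ 2 * (m + 1 - 13) := by omega
      have : (m : ℝ) ≤ 2 * ((m + 1 - 13 : ℕ) : ℝ) := by exact_mod_cast this
      linarith
    refine le_trans ?_ h1
    calc (m : ℝ)^13 / (Nat.factorial 13 * 2^13) = ((m : ℝ)/2)^13 / Nat.factorial 13 := by
          rw [div_pow, div_div, mul_comm]
      _ ≤ _ := by
        gcongr
        try exact_mod_cast h2
  have t1 : 1 / (((N:ℝ)+2) * (N+1)) ≤ 1 / s := by
    apply one_div_le_one_div_of_le (by positivity)
    nlinarith [(Nat.cast_nonneg N : (0:ℝ) ≤ N)]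
  have t2 : (((N+2+1)^12 : ℕ) : ℝ) * (√(2 * (((N+2 : ℕ) : ℝ) + 1)) / (m.choose 13 : ℕ)) ≤
      6^12 * 4 * (Nat.factorial 13 * 2^13) / s := by
    have : (((N+2+1)^12 : ℕ) : ℝ) ≤ (6 * (m:ℝ))^12 := by exact_mod_cast Nat.pow_le_pow_left hm2 12
    calc _ ≤ (6 * (m:ℝ))^12 * (4 * s / ((m : ℝ)^13 / (Nat.factorial 13 * 2^13))) := by
          gcongr
      _ = _ := by
        rw [← hss]
        generalize ((Nat.factorial 13 : ℕ) : ℝ) = f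
        field_simp
  have t3 : √(2 * (((N+2 : ℕ) : ℝ) + 1)) / m ≤ 4 / s := by
    calc _ ≤ 4 * s / m := by gcongr
      _ = _ := by rw [← hss]; field_simp
  refine h.trans ?_
  calc _ ≤ 1 / s + 6^12 * 4 * (Nat.factorial 13 * 2^13) / s + 2 * (((3 * 13 + 1) ^ (3 * 13) : ℕ) * (4 / s)) := by
        gcongr
    _ = _ := by
      generalize ((Nat.factorial 13 : ℕ) : ℝ) = f
      generalize (((3 * 13 + 1) ^ (3 * 13) : ℕ) : ℝ) = f
      ring

end Fin2

end Part12

/-- `E[G_n] = n/2 - log(n)/2 - γ/2 + 1 + o(1)`. -/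
theorem genus_expectation :
    Filter.Tendsto (fun n : ℕ => expGenus n - ((n : ℝ) / 2 - Real.log n / 2))
      Filter.atTop (nhds (1 - Real.eulerMascheroniConstant / 2)) := by
  obtain ⟨C, hC⟩ := expC_asymp
  have h1 : Filter.Tendsto (fun n : ℕ => C / √((n / 3 : ℕ) : ℝ)) Filter.atTop (nhds 0) := by
    apply Filter.Tendsto.div_atTop tendsto_const_nhds
    apply Real.tendsto_sqrt_atTop.comp
    apply tendsto_natCast_atTop_atTop.comp
    exact Nat.tendsto_div_const_atTop (by norm_num)
  have h2 : Filter.Tendsto (fun n : ℕ => expC n - (harmonic n : ℝ)) Filter.atTop (nhds 0) := by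
    apply squeeze_zero_norm' _ h1
    filter_upwards [Filter.eventually_ge_atTop 90] with n hn
    exact hC n hn
  have h3 := ((h2.add Real.tendsto_harmonic_sub_log).div_const 2).const_sub 1
  rw [zero_add] at h3
  refine h3.congr fun n => ?_
  rw [expGenus_eq]
  ring
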